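/- For every ε > 0 there exists x₀ such that for all real x ≥ x₀, the number of radimichael numbers up to x is at least x^{1/2 − ε}. (In other words, the count of radimichael numbers up to x is at least x^{1/2 + o(1)} as x → ∞.) -/

import Mathlib

/-- The radical of a natural number: the product of its distinct prime factors,
i.e. its largest squarefree divisor. -/
def rad (n : ℕ) : ℕ := ∏ p ∈ n.primeFactors, p

section Preliminaries

open Complex MeasureTheory Filter Topology

section CharacterSums

variable {q : ℕ} [NeZero q]

lemma DirichletCharacter.sum_range_add_eq_zero {χ : DirichletCharacter ℂ q} (hχ : χ ≠ 1) (c : ℕ) :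
    ∑ i ∈ Finset.range q, χ ((c + i : ℕ) : ZMod q) = 0 := by
  have h1 : ∑ a : ZMod q, χ ((c : ZMod q) + a) = 0 := by
    rw [← MulChar.sum_eq_zero_of_ne_one hχ]
    exact Equiv.sum_comp (Equiv.addLeft (c : ZMod q)) (fun a => χ a)
  rw [← h1]
  refine Finset.sum_nbij' (fun i => (i : ZMod q)) ZMod.val ?_ ?_ ?_ ?_ ?_
  · simp
  · intro a _
    exact Finset.mem_range.2 (ZMod.val_lt a)
  · intro i hi
    exact ZMod.val_cast_of_lt (Finset.mem_range.1 hi)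
  · simp
  · intro i _
    push_cast
    rfl

lemma DirichletCharacter.norm_sum_Icc_le {q : ℕ} (χ : DirichletCharacter ℂ q) (n : ℕ) :
    ‖∑ k ∈ Finset.Icc 1 n, χ (k : ZMod q)‖ ≤ n := by
  refine (norm_sum_le_of_le _ (fun k _ => χ.norm_le_one _)).trans ?_
  simp

lemma DirichletCharacter.norm_sum_Icc_le_level {χ : DirichletCharacter ℂ q} (hχ : χ ≠ 1) (n : ℕ) :
    ‖∑ k ∈ Finset.Icc 1 n, χ (k : ZMod q)‖ ≤ q := by
  have key (n : ℕ) : ∑ k ∈ Finset.Icc 1 n, χ (k : ZMod q) =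
      ∑ k ∈ Finset.range n, χ ((1 + k : ℕ) : ZMod q) := by
    have h := Finset.sum_Ico_add' (fun k : ℕ => χ ((k : ℕ) : ZMod q)) 0 n 1
    rw [zero_add] at h
    rw [Finset.range_eq_Ico]
    simp_rw [add_comm 1]
    exact h.symm
  induction n using Nat.strong_induction_on with
  | _ n ih =>
    by_cases h : n < q
    · exact (χ.norm_sum_Icc_le n).trans (by exact_mod_cast h.le)
    · have hq : 0 < q := Nat.pos_of_neZero q
      obtain ⟨m, rfl⟩ := Nat.exists_eq_add_of_le' (not_lt.1 h)
      rw [key, Finset.sum_range_add, ← key]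
      have := DirichletCharacter.sum_range_add_eq_zero hχ (1 + m)
      simp only [← add_assoc]
      rw [this, add_zero]
      exact ih m (by omega)

end CharacterSums

section Integral

variable {q : ℕ} [NeZero q]

/-- The analytic continuation of a nontrivial Dirichlet `L`-function to `0 < re s` by partial
summation. -/
lemma DirichletCharacter.LFunction_eq_mul_integral {χ : DirichletCharacter ℂ q} (hχ : χ ≠ 1)
    {s : ℂ} (hs : 0 < s.re) :
    LFunction χ s = s * ∫ t in Set.Ioi (1 : ℝ),
      (∑ k ∈ Finset.Icc 1 ⌊t⌋₊, χ (k : ZMod q)) * (t : ℂ) ^ (-(s + 1)) := by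
  set A : ℝ → ℂ := fun t => ∑ k ∈ Finset.Icc 1 ⌊t⌋₊, χ (k : ZMod q) with hA
  have hbd (t : ℝ) : ‖A t‖ ≤ q := DirichletCharacter.norm_sum_Icc_le_level hχ _
  have hmeas : Measurable A :=
    (measurable_from_nat (f := fun n => ∑ k ∈ Finset.Icc 1 n, χ (k : ZMod q))).comp
      Nat.measurable_floor
  have hzero (t : ℝ) (ht : t < 1) : A t = 0 := by
    simp [hA, Nat.floor_eq_zero.2 ht]
  have hmel (s : ℂ) : mellin A (-s) = ∫ t in Set.Ioi (1 : ℝ), A t * (t : ℂ) ^ (-(s + 1)) := by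
    have hsub : Set.Ioi (1 : ℝ) ⊆ Set.Ioi 0 := Set.Ioi_subset_Ioi zero_le_one
    rw [mellin]
    symm
    rw [← setIntegral_eq_of_subset_of_ae_sdiff_eq_zero (s := Set.Ioi (1 : ℝ))
      measurableSet_Ioi.nullMeasurableSet hsub]
    · refine setIntegral_congr_fun measurableSet_Ioi fun t _ => ?_
      simp only [smul_eq_mul]
      rw [mul_comm]
      congr 2
      ring
    · have h1 : ∀ᵐ t : ℝ, t ≠ 1 := by simp [ae_iff, measure_singleton]
      filter_upwards [h1] with t ht hmem
      have : t < 1 := lt_of_le_of_ne (not_lt.1 fun h => hmem.2 h) ht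
      simp [hzero t this]
  have hdiff (s : ℂ) (hs : 0 < s.re) : DifferentiableAt ℂ (mellin A) (-s) := by
    refine mellin_differentiableAt_of_isBigO_rpow (a := 0) (b := -s.re - 1) ?_ ?_ ?_ ?_ ?_
    · have : LocallyIntegrable (fun _ : ℝ => (q : ℝ)) := locallyIntegrable_const _
      refine (this.mono hmeas.aestronglyMeasurable ?_).locallyIntegrableOn _
      filter_upwards with t
      simpa using hbd t
    · refine Asymptotics.IsBigO.of_bound q ?_
      filter_upwards with t
      simpa using hbd t
    · simpa using hs
    · refine Asymptotics.IsBigO.of_bound 1 ?_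
      filter_upwards [mem_nhdsWithin_of_mem_nhds (Iio_mem_nhds (zero_lt_one' ℝ))] with t ht
      rw [hzero t ht]
      simp
    · simp
  have hU : IsOpen {s : ℂ | 0 < s.re} := isOpen_lt continuous_const continuous_re
  have hcv : Convex ℝ {s : ℂ | 0 < s.re} := convex_halfSpace_re_gt 0
  have hF : DifferentiableOn ℂ (fun s : ℂ => s * mellin A (-s)) {s : ℂ | 0 < s.re} := by
    intro s hs
    have h1 : DifferentiableAt ℂ (fun s : ℂ => mellin A (-s)) s :=
      (hdiff s hs).comp s (differentiableAt_id.neg)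
    exact (differentiableAt_id.mul h1).differentiableWithinAt
  have heq := AnalyticOnNhd.eqOn_of_preconnected_of_eventuallyEq
    ((differentiable_LFunction hχ).differentiableOn.analyticOnNhd hU)
    (hF.analyticOnNhd hU) hcv.isPreconnected (z₀ := 2) (by simp) ?_
  · rw [← hmel]
    exact heq hs
  · have h2 : {s : ℂ | 1 < s.re} ∈ 𝓝 (2 : ℂ) :=
      (isOpen_lt continuous_const continuous_re).mem_nhds (by simp)
    filter_upwards [h2] with s hs
    have hs' : 1 < s.re := hs
    rw [LFunction_eq_LSeries χ hs', hmel]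
    refine LSeries_eq_mul_integral _ le_rfl (by linarith)
      (DirichletCharacter.LSeriesSummable_of_one_lt_re χ hs') ?_
    refine Asymptotics.IsBigO.of_bound q ?_
    filter_upwards with n
    simpa using DirichletCharacter.norm_sum_Icc_le_level hχ n

lemma DirichletCharacter.norm_LFunction_le {χ : DirichletCharacter ℂ q} (hχ : χ ≠ 1)
    {s : ℂ} (hs : ‖s - 1‖ ≤ 1 / (3 + Real.log q)) :
    ‖LFunction χ s‖ ≤ 4 * (3 + Real.log q) := by
  have hq1 : (1 : ℝ) ≤ q := by exact_mod_cast Nat.one_le_iff_ne_zero.2 (NeZero.ne q)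
  have hlog : 0 ≤ Real.log q := Real.log_nonneg hq1
  set ℓ := 3 + Real.log q with hℓ
  have hℓ3 : 3 ≤ ℓ := by linarith
  have hinv : 1 / ℓ ≤ 1 / 3 := one_div_le_one_div_of_le (by norm_num) hℓ3
  have hre : 1 - 1 / ℓ ≤ s.re := by
    have := (abs_re_le_norm (s - 1)).trans hs
    simp only [sub_re, one_re] at this
    linarith [(abs_le.1 this).1]
  have hre23 : 2 / 3 ≤ s.re := by linarith
  have hns : ‖s‖ ≤ 4 / 3 := by
    have : ‖s‖ ≤ ‖s - 1‖ + ‖(1 : ℂ)‖ := by simpa using norm_add_le (s - 1) 1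
    rw [norm_one] at this
    linarith
  set e := Real.exp 1
  have hqpow : (q : ℝ) ^ (1 / ℓ) ≤ e := by
    rw [Real.rpow_def_of_pos (by linarith)]
    refine Real.exp_le_exp.2 ?_
    rw [mul_one_div, div_le_one (by linarith)]
    linarith
  have hmeas : Measurable fun t : ℝ => ∑ k ∈ Finset.Icc 1 ⌊t⌋₊, χ (k : ZMod q) :=
    (measurable_from_nat (f := fun n => ∑ k ∈ Finset.Icc 1 n, χ (k : ZMod q))).comp
      Nat.measurable_floor
  have hnorm (t : ℝ) (ht : 0 < t) : ‖(t : ℂ) ^ (-(s + 1))‖ = t ^ (-(s.re + 1)) := by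
    rw [Complex.norm_cpow_eq_rpow_re_of_pos ht]
    simp
  have hint2 : IntegrableOn (fun t : ℝ => (q : ℝ) * t ^ (-(s.re + 1))) (Set.Ioi (q : ℝ)) :=
    (integrableOn_Ioi_rpow_of_lt (by linarith) (by linarith)).const_mul _
  have hint1 : IntegrableOn (fun t : ℝ => e * t⁻¹) (Set.Ioc 1 (q : ℝ)) := by
    have : IntervalIntegrable (fun t : ℝ => e * t⁻¹) volume 1 q := by
      refine (intervalIntegral.intervalIntegrable_inv (fun t ht => ?_)
        continuousOn_id).const_mul _
      rw [Set.uIcc_of_le hq1] at ht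
      have := ht.1
      simp only [id]
      linarith
    exact (intervalIntegrable_iff_integrableOn_Ioc_of_le hq1).1 this
  have hb1 : ∀ t ∈ Set.Ioc 1 (q : ℝ),
      ‖(∑ k ∈ Finset.Icc 1 ⌊t⌋₊, χ (k : ZMod q)) * (t : ℂ) ^ (-(s + 1))‖ ≤ e * t⁻¹ := by
    intro t ht
    have ht0 : 0 < t := by linarith [ht.1]
    rw [norm_mul, hnorm t ht0]
    calc _ ≤ t * t ^ (-(s.re + 1)) := by
            gcongr
            exact (χ.norm_sum_Icc_le _).trans (Nat.floor_le ht0.le)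
      _ = t ^ (1 - s.re) * t⁻¹ := by
            rw [← Real.rpow_neg_one, ← Real.rpow_add ht0, ← Real.rpow_one_add' ht0.le]
            · congr 1; ring
            · linarith
      _ ≤ e * t⁻¹ := by
            gcongr
            refine le_trans ?_ hqpow
            calc t ^ (1 - s.re) ≤ t ^ (1 / ℓ) :=
                  Real.rpow_le_rpow_of_exponent_le ht.1.le (by linarith)
              _ ≤ _ := Real.rpow_le_rpow ht0.le ht.2 (by positivity)
  have hb2 : ∀ t ∈ Set.Ioi (q : ℝ),
      ‖(∑ k ∈ Finset.Icc 1 ⌊t⌋₊, χ (k : ZMod q)) * (t : ℂ) ^ (-(s + 1))‖ ≤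
        q * t ^ (-(s.re + 1)) := by
    intro t ht
    have ht0 : 0 < t := by linarith [Set.mem_Ioi.1 ht]
    rw [norm_mul, hnorm t ht0]
    gcongr
    exact DirichletCharacter.norm_sum_Icc_le_level hχ _
  have hasm : Measurable fun t : ℝ =>
      (∑ k ∈ Finset.Icc 1 ⌊t⌋₊, χ (k : ZMod q)) * (t : ℂ) ^ (-(s + 1)) := by
    fun_prop
  have hi1 := hint1.mono' hasm.aestronglyMeasurable.restrict
    ((ae_restrict_iff' measurableSet_Ioc).2 (ae_of_all _ hb1))
  have hi2 := hint2.mono' hasm.aestronglyMeasurable.restrict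
    ((ae_restrict_iff' measurableSet_Ioi).2 (ae_of_all _ hb2))
  rw [DirichletCharacter.LFunction_eq_mul_integral hχ (by linarith), ← Set.Ioc_union_Ioi_eq_Ioi hq1,
    setIntegral_union (Set.Ioc_disjoint_Ioi le_rfl) measurableSet_Ioi hi1 hi2, norm_mul]
  have hI1 : ‖∫ t in Set.Ioc 1 (q : ℝ),
      (∑ k ∈ Finset.Icc 1 ⌊t⌋₊, χ (k : ZMod q)) * (t : ℂ) ^ (-(s + 1))‖ ≤ e * Real.log q := by
    refine (norm_integral_le_of_norm_le hint1
      ((ae_restrict_iff' measurableSet_Ioc).2 (ae_of_all _ hb1))).trans_eq ?_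
    rw [← intervalIntegral.integral_of_le hq1, intervalIntegral.integral_const_mul,
      integral_inv_of_pos one_pos (by linarith), div_one]
  have hI2 : ‖∫ t in Set.Ioi (q : ℝ),
      (∑ k ∈ Finset.Icc 1 ⌊t⌋₊, χ (k : ZMod q)) * (t : ℂ) ^ (-(s + 1))‖ ≤ e * (3 / 2) := by
    refine (norm_integral_le_of_norm_le hint2
      ((ae_restrict_iff' measurableSet_Ioi).2 (ae_of_all _ hb2))).trans ?_
    rw [integral_const_mul, integral_Ioi_rpow_of_lt (by linarith) (by linarith)]
    have h1 : -(s.re + 1) + 1 = -s.re := by ring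
    rw [h1, neg_div_neg_eq, ← mul_div_assoc, div_le_iff₀ (by linarith)]
    have h2 : (q : ℝ) * (q : ℝ) ^ (-s.re) ≤ e := by
      nth_rewrite 1 [← Real.rpow_one (q : ℝ)]
      rw [← Real.rpow_add (by linarith)]
      exact (Real.rpow_le_rpow_of_exponent_le hq1 (by linarith)).trans hqpow
    have he : 0 < e := Real.exp_pos 1
    nlinarith
  have he : e < 2.7182818286 := Real.exp_one_lt_d9
  calc _ ≤ 4 / 3 * (e * Real.log q + e * (3 / 2)) := by
        gcongr
        exact (norm_add_le _ _).trans (add_le_add hI1 hI2)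
    _ ≤ 4 * ℓ := by
        rw [hℓ]
        nlinarith

end Integral

section NearOne

variable {q : ℕ} [NeZero q]

lemma DirichletCharacter.norm_LFunction_one_le {x : ℝ} (hx : 0 < x) :
    ‖LFunction (1 : DirichletCharacter ℂ q) (1 + x)‖ ≤ (1 + x) / x := by
  have hre : ((1 : ℂ) + x).re = 1 + x := by simp
  have hs : 1 < ((1 : ℂ) + x).re := by rw [hre]; linarith
  rw [LFunction_eq_LSeries _ hs, LSeries_eq_mul_integral (r := 1) _ zero_le_one hs
    (DirichletCharacter.LSeriesSummable_of_one_lt_re 1 hs), norm_mul]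
  · have h1 : ‖(1 : ℂ) + x‖ = 1 + x := by
      rw [← ofReal_one, ← ofReal_add, norm_real, Real.norm_of_nonneg (by linarith)]
    rw [h1, div_eq_mul_one_div]
    gcongr
    have hintg : IntegrableOn (fun t : ℝ => t ^ (-(1 + x))) (Set.Ioi (1 : ℝ)) :=
      integrableOn_Ioi_rpow_of_lt (by linarith) one_pos
    refine (norm_integral_le_of_norm_le hintg
      ((ae_restrict_iff' measurableSet_Ioi).2 (ae_of_all _ ?_))).trans_eq ?_
    · intro t ht
      have ht0 : 0 < t := by linarith [Set.mem_Ioi.1 ht]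
      rw [norm_mul, Complex.norm_cpow_eq_rpow_re_of_pos ht0]
      have h2 : (-((1 : ℂ) + x + 1)).re = -(1 + x) - 1 := by simp; ring
      rw [h2, Real.rpow_sub_one ht0.ne', ← mul_div_assoc, div_le_iff₀ ht0, mul_comm]
      gcongr
      exact (DirichletCharacter.norm_sum_Icc_le _ _).trans (Nat.floor_le ht0.le)
    · rw [integral_Ioi_rpow_of_lt (by linarith) one_pos, Real.one_rpow]
      have h3 : -(1 + x) + 1 = -x := by ring
      rw [h3, neg_div_neg_eq]
  · refine Asymptotics.IsBigO.of_bound 1 ?_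
    filter_upwards with n
    simpa using DirichletCharacter.norm_sum_Icc_le (1 : DirichletCharacter ℂ q) n

lemma DirichletCharacter.norm_deriv_LFunction_le {χ : DirichletCharacter ℂ q} (hχ : χ ≠ 1)
    {s : ℂ} (hs : ‖s - 1‖ ≤ 1 / (2 * (3 + Real.log q))) :
    ‖deriv (LFunction χ) s‖ ≤ 8 * (3 + Real.log q) ^ 2 := by
  have hq1 : (1 : ℝ) ≤ q := by exact_mod_cast Nat.one_le_iff_ne_zero.2 (NeZero.ne q)
  have hlog : 0 ≤ Real.log q := Real.log_nonneg hq1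
  set ℓ := 3 + Real.log q with hℓ
  have hℓ3 : 3 ≤ ℓ := by linarith
  have := Complex.norm_deriv_le_of_forall_mem_sphere_norm_le (c := s) (R := 1 / (2 * ℓ))
    (C := 4 * ℓ) (f := LFunction χ) (by positivity)
    (differentiable_LFunction hχ).diffContOnCl ?_
  · refine this.trans_eq ?_
    field_simp
    ring
  · intro z hz
    refine DirichletCharacter.norm_LFunction_le hχ ?_
    have hz' : ‖z - s‖ = 1 / (2 * ℓ) := by simpa [dist_eq_norm] using hz
    calc ‖z - 1‖ = ‖(z - s) + (s - 1)‖ := by ring_nf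
      _ ≤ 1 / (2 * ℓ) + 1 / (2 * ℓ) := (norm_add_le _ _).trans (add_le_add hz'.le hs)
      _ = 1 / ℓ := by field_simp; norm_num

/-- A zero-free disc around `1` for the `L`-function of a non-quadratic character. -/
lemma DirichletCharacter.le_norm_LFunction {χ : DirichletCharacter ℂ q} (hχ : χ ^ 2 ≠ 1)
    {s : ℂ} (hs : ‖s - 1‖ ≤ 1 / (2 ^ 25 * (3 + Real.log q) ^ 9)) :
    1 / (2 ^ 21 * (3 + Real.log q) ^ 7) ≤ ‖LFunction χ s‖ := by
  have hχ1 : χ ≠ 1 := by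
    rintro rfl
    simp at hχ
  have hq1 : (1 : ℝ) ≤ q := by exact_mod_cast Nat.one_le_iff_ne_zero.2 (NeZero.ne q)
  have hlog : 0 ≤ Real.log q := Real.log_nonneg hq1
  set ℓ := 3 + Real.log q with hℓ
  have hℓ3 : 3 ≤ ℓ := by linarith
  set δ : ℝ := 1 / (2 ^ 25 * ℓ ^ 9) with hδ
  have hδ0 : 0 < δ := by positivity
  have hδℓ : δ ≤ 1 / (2 * ℓ) := by
    refine one_div_le_one_div_of_le (by positivity) ?_
    have : (1 : ℝ) ≤ ℓ ^ 8 := one_le_pow₀ (by linarith)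
    calc 2 * ℓ ≤ 2 ^ 25 * (ℓ * 1) := by nlinarith
      _ ≤ 2 ^ 25 * (ℓ * ℓ ^ 8) := by gcongr
      _ = _ := by ring
  have hδ1 : δ ≤ 1 := hδℓ.trans (by rw [div_le_one (by positivity)]; linarith)
  have hsub : ‖((1 : ℂ) + δ) - 1‖ = δ := by simp [abs_of_pos hδ0]
  have hreal : 1 / (2 ^ 20 * ℓ ^ 7) ≤ ‖LFunction χ (1 + δ)‖ := by
    have h341 := DirichletCharacter.norm_LFunction_product_ge_one χ hδ0 0
    simp only [ofReal_zero, mul_zero, add_zero, norm_mul, norm_pow] at h341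
    have hT : ‖LFunctionTrivChar q (1 + δ)‖ ≤ 2 / δ := by
      refine (DirichletCharacter.norm_LFunction_one_le hδ0).trans ?_
      gcongr
      linarith
    have h2 : ‖LFunction (χ ^ 2) (1 + δ)‖ ≤ 4 * ℓ := by
      refine DirichletCharacter.norm_LFunction_le hχ ?_
      rw [hsub]
      refine hδℓ.trans (one_div_le_one_div_of_le (by positivity) (by linarith))
    set X := ‖LFunction χ (1 + δ)‖
    have h3 : 1 ≤ (2 / δ) ^ 3 * X ^ 4 * (4 * ℓ) := h341.le.trans (by gcongr)
    have h4 : (1 / (2 ^ 20 * ℓ ^ 7)) ^ 4 ≤ X ^ 4 := by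
      rw [one_div, inv_pow, inv_le_iff_one_le_mul₀' (by positivity)]
      refine h3.trans_eq ?_
      rw [hδ]
      field_simp
      norm_num
      ring
    exact le_of_pow_le_pow_left₀ (by norm_num) (norm_nonneg _) h4
  have hdiff : ‖LFunction χ s - LFunction χ (1 + δ)‖ ≤ 8 * ℓ ^ 2 * ‖s - (1 + δ)‖ := by
    refine (convex_closedBall (1 : ℂ) δ).norm_image_sub_le_of_norm_deriv_le
      (fun z _ => (differentiable_LFunction hχ1).differentiableAt) (fun z hz => ?_) ?_ ?_
    · refine DirichletCharacter.norm_deriv_LFunction_le hχ1 ?_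
      rw [mem_closedBall_iff_norm] at hz
      exact hz.trans hδℓ
    · rw [mem_closedBall_iff_norm, hsub]
    · rwa [mem_closedBall_iff_norm]
  have hdist : ‖s - (1 + δ)‖ ≤ 2 * δ := by
    calc ‖s - (1 + δ)‖ = ‖(s - 1) - ((1 + δ) - 1)‖ := by ring_nf
      _ ≤ δ + δ := (norm_sub_le _ _).trans (add_le_add hs hsub.le)
      _ = _ := by ring
  have hfin : ‖LFunction χ s - LFunction χ (1 + δ)‖ ≤ 1 / (2 ^ 21 * ℓ ^ 7) := by
    refine hdiff.trans ((mul_le_mul_of_nonneg_left hdist (by positivity)).trans_eq ?_)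
    rw [hδ]
    field_simp
    norm_num
  have htri : ‖LFunction χ (1 + δ)‖ ≤ ‖LFunction χ s‖ + ‖LFunction χ s - LFunction χ (1 + δ)‖ := by
    have := norm_sub_le (LFunction χ s) (LFunction χ s - LFunction χ (1 + δ))
    simpa using this
  have harith : 1 / (2 ^ 20 * ℓ ^ 7) = 1 / (2 ^ 21 * ℓ ^ 7) + 1 / (2 ^ 21 * ℓ ^ 7) := by
    field_simp
    norm_num
  linarith

lemma DirichletCharacter.norm_logDeriv_LFunction_le {χ : DirichletCharacter ℂ q} (hχ : χ ^ 2 ≠ 1)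
    {δ : ℝ} (hδ : 0 < δ) (hδ' : δ ≤ 1 / (2 ^ 25 * (3 + Real.log q) ^ 9)) {s : ℂ}
    (hs : ‖s - 1‖ ≤ δ) :
    ‖deriv (LFunction χ) s / LFunction χ s‖ ≤ 1 / (2 * δ) := by
  have hχ1 : χ ≠ 1 := by
    rintro rfl
    simp at hχ
  have hq1 : (1 : ℝ) ≤ q := by exact_mod_cast Nat.one_le_iff_ne_zero.2 (NeZero.ne q)
  have hlog : 0 ≤ Real.log q := Real.log_nonneg hq1
  have hL := DirichletCharacter.le_norm_LFunction hχ (hs.trans hδ')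
  have hL' : ‖deriv (LFunction χ) s‖ ≤ 8 * (3 + Real.log q) ^ 2 := by
    refine DirichletCharacter.norm_deriv_LFunction_le hχ1 (hs.trans (hδ'.trans ?_))
    set ℓ := 3 + Real.log q with hℓ
    have hℓ3 : 3 ≤ ℓ := by linarith
    refine one_div_le_one_div_of_le (by positivity) ?_
    have : (1 : ℝ) ≤ ℓ ^ 8 := one_le_pow₀ (by linarith)
    calc 2 * ℓ ≤ 2 ^ 25 * (ℓ * 1) := by nlinarith
      _ ≤ 2 ^ 25 * (ℓ * ℓ ^ 8) := by gcongr
      _ = _ := by ring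
  set ℓ := 3 + Real.log q with hℓ
  have hℓ3 : 3 ≤ ℓ := by linarith
  rw [norm_div]
  calc _ ≤ 8 * ℓ ^ 2 / (1 / (2 ^ 21 * ℓ ^ 7)) := by gcongr
    _ = 1 / (2 * (1 / (2 ^ 25 * ℓ ^ 9))) := by field_simp; norm_num
    _ ≤ 1 / (2 * δ) := by gcongr

end NearOne

section SmallModulus

/-- A quadratic character modulo an odd number factors through any divisor
with the same prime factors. -/
lemma DirichletCharacter.factorsThrough_of_sq_eq_one {r t : ℕ} [NeZero r] [NeZero t] (hrt : r ∣ t)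
    (hodd : _root_.Odd t) (hpf : t.primeFactors = r.primeFactors) {χ : DirichletCharacter ℂ t}
    (hχ : χ ^ 2 = 1) : χ.FactorsThrough r := by
  rw [DirichletCharacter.factorsThrough_iff_ker_unitsMap hrt]
  intro u hu
  have hcard : Nat.card (ZMod.unitsMap hrt).ker * r = t := by
    have h1 := Nat.totient_mul_prod_primeFactors t
    have h2 := Nat.totient_mul_prod_primeFactors r
    rw [hpf] at h1
    have h3 := (ZMod.unitsMap hrt).ker.card_mul_index
    rw [Subgroup.index_ker, MonoidHom.range_eq_top.2 (ZMod.unitsMap_surjective hrt),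
      Subgroup.card_top, Nat.card_eq_fintype_card (α := (ZMod r)ˣ),
      Nat.card_eq_fintype_card (α := (ZMod t)ˣ), ZMod.card_units_eq_totient,
      ZMod.card_units_eq_totient] at h3
    have hP : 0 < ∏ p ∈ r.primeFactors, (p - 1) := Finset.prod_pos fun p hp =>
      Nat.sub_pos_of_lt (Nat.prime_of_mem_primeFactors hp).one_lt
    apply Nat.eq_of_mul_eq_mul_right hP
    rw [← h1, ← h3, mul_assoc, mul_assoc, h2]
  have hodd' : _root_.Odd (Nat.card (ZMod.unitsMap hrt).ker) := by
    rw [← hcard] at hodd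
    exact (Nat.odd_mul.1 hodd).1
  have hu1 : u ^ Nat.card (ZMod.unitsMap hrt).ker = 1 := by
    have := pow_card_eq_one' (x := (⟨u, hu⟩ : (ZMod.unitsMap hrt).ker))
    simpa using congrArg Subtype.val this
  rw [MonoidHom.mem_ker]
  set v := MulChar.toUnitHom χ u with hv
  have hv2 : v ^ 2 = 1 := by
    ext
    rw [hv, Units.val_pow_eq_pow_val, MulChar.coe_toUnitHom, ← MulChar.pow_apply_coe, hχ]
    simp
  have hvc : v ^ Nat.card (ZMod.unitsMap hrt).ker = 1 := by rw [hv, ← map_pow, hu1, map_one]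
  obtain ⟨j, hj⟩ := hodd'
  rw [hj, pow_succ, pow_mul, hv2, one_pow, one_mul] at hvc
  exact hvc

lemma DirichletCharacter.LFunction_changeLevel_eq {r t : ℕ} [NeZero r] [NeZero t] (hrt : r ∣ t)
    (hpf : t.primeFactors = r.primeFactors) (χ : DirichletCharacter ℂ r) {s : ℂ} (hs : s ≠ 1) :
    LFunction (changeLevel hrt χ) s = LFunction χ s := by
  rw [LFunction_changeLevel hrt χ (Or.inr hs), Finset.prod_eq_one, mul_one]
  intro p hp
  rw [hpf] at hp
  have : χ (p : ZMod r) = 0 := by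
    refine χ.map_nonunit fun h => ?_
    have hc := (ZMod.isUnit_iff_coprime p r).1 h
    exact (Nat.prime_of_mem_primeFactors hp).one_lt.ne'
      (Nat.eq_one_of_dvd_coprimes hc dvd_rfl (Nat.dvd_of_mem_primeFactors hp))
  rw [this, zero_mul, sub_zero]

/-- `G` is a holomorphic function on the disc of radius `δ` around `1`, bounded by `1 / (2 * δ)`,
that equals `-L'/L` up to the polar part. -/
def IsRegularPart {q : ℕ} [NeZero q] (χ : DirichletCharacter ℂ q) (δ : ℝ) (G : ℂ → ℂ) : Prop :=
  DifferentiableOn ℂ G (Metric.ball 1 δ) ∧ (∀ s ∈ Metric.ball (1 : ℂ) δ, ‖G s‖ ≤ 1 / (2 * δ)) ∧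
    ∀ s ∈ Metric.ball (1 : ℂ) δ, 1 < s.re →
      -(deriv (DirichletCharacter.LFunction χ) s / DirichletCharacter.LFunction χ s) =
        (open Classical in if χ = 1 then 1 / (s - 1) else 0) + G s

lemma eventually_logDeriv_bound {f : ℂ → ℂ} (hf : Differentiable ℂ f) (h1 : f 1 ≠ 0) :
    ∀ᶠ δ in 𝓝[>] (0 : ℝ), (∀ s ∈ Metric.ball (1 : ℂ) δ, f s ≠ 0) ∧
      DifferentiableOn ℂ (fun s => -(deriv f s / f s)) (Metric.ball 1 δ) ∧
      ∀ s ∈ Metric.ball (1 : ℂ) δ, ‖-(deriv f s / f s)‖ ≤ 1 / (2 * δ) := by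
  have hd : Differentiable ℂ (deriv f) := by
    have := hf.contDiff (n := 2)
    exact (this.differentiable_deriv_two)
  have hne : ∀ᶠ s in 𝓝 (1 : ℂ), f s ≠ 0 := hf.continuous.continuousAt.eventually_ne h1
  have hcont : ContinuousAt (fun s => ‖-(deriv f s / f s)‖) 1 :=
    ((hd.continuous.continuousAt.div hf.continuous.continuousAt h1).neg).norm
  have hbd : ∀ᶠ s in 𝓝 (1 : ℂ), ‖-(deriv f s / f s)‖ < ‖-(deriv f 1 / f 1)‖ + 1 :=
    hcont.eventually_lt continuousAt_const (by simp)
  obtain ⟨ρ, hρ, hball⟩ := Metric.eventually_nhds_iff_ball.1 (hne.and hbd)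
  set C := ‖-(deriv f 1 / f 1)‖ + 1
  have hC : 0 < C := by positivity
  have hmin : 0 < min ρ (1 / (2 * C)) := by positivity
  filter_upwards [Ioo_mem_nhdsGT hmin] with δ hδ
  have hsub : Metric.ball (1 : ℂ) δ ⊆ Metric.ball 1 ρ :=
    Metric.ball_subset_ball (hδ.2.le.trans (min_le_left _ _))
  refine ⟨fun s hs => (hball s (hsub hs)).1, fun s hs => ?_, fun s hs => ?_⟩
  · exact ((hd s).div (hf s) (hball s (hsub hs)).1).neg.differentiableWithinAt
  · refine (hball s (hsub hs)).2.le.trans ?_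
    have hδC := hδ.2.le.trans (min_le_right _ _)
    rw [le_div_iff₀ (by positivity)] at hδC
    rw [le_div_iff₀ (by linarith [hδ.1])]
    linarith

lemma eventually_exists_isRegularPart {r : ℕ} [NeZero r] (χ : DirichletCharacter ℂ r) :
    ∀ᶠ δ in 𝓝[>] (0 : ℝ), ∃ G, IsRegularPart χ δ G := by
  by_cases hχ : χ = 1
  · subst hχ
    filter_upwards [eventually_logDeriv_bound
      (DirichletCharacter.differentiable_LFunctionTrivChar₁ r)
      (DirichletCharacter.LFunctionTrivChar₁_apply_one_ne_zero r)] with δ hδ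
    refine ⟨_, hδ.2.1, hδ.2.2, fun s hs hre => ?_⟩
    have hs1 : s ≠ 1 := by
      rintro rfl
      simp at hre
    have h0 := hδ.1 s hs
    rw [DirichletCharacter.deriv_LFunctionTrivChar₁_apply_of_ne_one r hs1]
    rw [DirichletCharacter.LFunctionTrivChar₁, Function.update_of_ne hs1] at h0 ⊢
    have hs1' := sub_ne_zero.2 hs1
    have h0' := right_ne_zero_of_mul h0
    simp only [if_true]
    rw [DirichletCharacter.LFunctionTrivChar] at h0' ⊢
    field_simp
    ring
  · filter_upwards [eventually_logDeriv_bound (DirichletCharacter.differentiable_LFunction hχ)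
      (DirichletCharacter.LFunction_apply_one_ne_zero hχ)] with δ hδ
    refine ⟨_, hδ.2.1, hδ.2.2, fun s hs hre => ?_⟩
    simp [hχ]

lemma isRegularPart_changeLevel {r t : ℕ} [NeZero r] [NeZero t] (hrt : r ∣ t)
    (hpf : t.primeFactors = r.primeFactors) {χ : DirichletCharacter ℂ r} {δ : ℝ} {G : ℂ → ℂ}
    (h : IsRegularPart χ δ G) :
    IsRegularPart (DirichletCharacter.changeLevel hrt χ) δ G := by
  refine ⟨h.1, h.2.1, fun s hs hre => ?_⟩
  have hs1 : s ≠ 1 := by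
    rintro rfl
    simp at hre
  have hev : DirichletCharacter.LFunction (DirichletCharacter.changeLevel hrt χ) =ᶠ[𝓝 s]
      DirichletCharacter.LFunction χ := by
    filter_upwards [isOpen_ne.mem_nhds hs1] with z hz
    exact DirichletCharacter.LFunction_changeLevel_eq hrt hpf χ hz
  rw [hev.deriv_eq, hev.self_of_nhds, h.2.2 s hs hre]
  simp only [DirichletCharacter.changeLevel_eq_one_iff]

lemma isRegularPart_of_sq_ne_one {t : ℕ} [NeZero t] {χ : DirichletCharacter ℂ t} (hχ : χ ^ 2 ≠ 1)
    {δ : ℝ} (hδ : 0 < δ) (hδ' : δ ≤ 1 / (2 ^ 25 * (3 + Real.log t) ^ 9)) :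
    IsRegularPart χ δ fun s =>
      -(deriv (DirichletCharacter.LFunction χ) s / DirichletCharacter.LFunction χ s) := by
  have hχ1 : χ ≠ 1 := by
    rintro rfl
    simp at hχ
  have hq1 : (1 : ℝ) ≤ t := by exact_mod_cast Nat.one_le_iff_ne_zero.2 (NeZero.ne t)
  have hlog : 0 ≤ Real.log t := Real.log_nonneg hq1
  have hf := DirichletCharacter.differentiable_LFunction hχ1
  have hd : Differentiable ℂ (deriv (DirichletCharacter.LFunction χ)) :=
    (hf.contDiff (n := 2)).differentiable_deriv_two
  refine ⟨fun s hs => ?_, fun s hs => ?_, fun s _ _ => by simp [hχ1]⟩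
  · have hs' : ‖s - 1‖ ≤ 1 / (2 ^ 25 * (3 + Real.log t) ^ 9) :=
      (mem_ball_iff_norm.1 hs).le.trans hδ'
    have := DirichletCharacter.le_norm_LFunction hχ hs'
    have h0 : DirichletCharacter.LFunction χ s ≠ 0 := by
      refine norm_pos_iff.1 (lt_of_lt_of_le ?_ this)
      positivity
    exact ((hd s).div (hf s) h0).neg.differentiableWithinAt
  · rw [norm_neg]
    exact DirichletCharacter.norm_logDeriv_LFunction_le hχ hδ hδ' (mem_ball_iff_norm.1 hs).le

lemma exists_forall_isRegularPart (r : ℕ) [NeZero r] :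
    ∃ δ₀ : ℝ, 0 < δ₀ ∧ ∀ (t : ℕ) [NeZero t], r ∣ t → _root_.Odd t → t.primeFactors = r.primeFactors →
      ∀ δ : ℝ, 0 < δ → δ < δ₀ → δ ≤ 1 / (2 ^ 25 * (3 + Real.log t) ^ 9) →
      ∀ χ : DirichletCharacter ℂ t, ∃ G, IsRegularPart χ δ G := by
  have h : ∀ᶠ δ in 𝓝[>] (0 : ℝ), ∀ χ : DirichletCharacter ℂ r, ∃ G, IsRegularPart χ δ G :=
    eventually_all.2 eventually_exists_isRegularPart
  obtain ⟨δ₀, hδ₀, hsub⟩ := mem_nhdsGT_iff_exists_Ioo_subset.1 h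
  refine ⟨δ₀, hδ₀, fun t _ hrt hodd hpf δ hδ hδδ₀ hδ' χ => ?_⟩
  by_cases hχ : χ ^ 2 = 1
  · obtain ⟨hd, χ₀, rfl⟩ := DirichletCharacter.factorsThrough_of_sq_eq_one hrt hodd hpf hχ
    obtain ⟨G, hG⟩ := hsub ⟨hδ, hδδ₀⟩ χ₀
    exact ⟨G, isRegularPart_changeLevel hd hpf hG⟩
  · exact ⟨_, isRegularPart_of_sq_ne_one hχ hδ hδ'⟩

end SmallModulus

section DerivativeEstimate

open ArithmeticFunction.vonMangoldt (residueClass)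

lemma LSeries.iterate_logMul_apply (f : ℕ → ℂ) (k n : ℕ) :
    LSeries.logMul^[k] f n = (Complex.log n) ^ k * f n := by
  induction k with
  | zero => simp
  | succ k ih =>
    rw [Function.iterate_succ_apply', LSeries.logMul, ih]
    ring

lemma LSeries.term_iterate_logMul_ofReal {f : ℕ → ℝ} (h0 : f 0 = 0) (k n : ℕ) (x : ℝ) :
    LSeries.term (LSeries.logMul^[k] fun n => (f n : ℂ)) x n =
      ((f n * Real.log n ^ k * (n : ℝ) ^ (-x) : ℝ) : ℂ) := by
  rw [LSeries.term_def, LSeries.iterate_logMul_apply]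
  split_ifs with hn
  · simp [hn, h0]
  · rw [Real.rpow_neg n.cast_nonneg]
    push_cast
    rw [Complex.ofReal_cpow n.cast_nonneg, Complex.ofReal_natCast, div_eq_mul_inv]
    ring

lemma iteratedDeriv_one_div_sub_one (k : ℕ) (s : ℂ) :
    iteratedDeriv k (fun z : ℂ => 1 / (z - 1)) s =
      (-1) ^ k * k.factorial * (s - 1) ^ (-1 - (k : ℤ)) := by
  rw [iteratedDeriv_comp_sub_const k (fun z : ℂ => 1 / z) 1, iteratedDeriv_eq_iterate]
  have : (fun z : ℂ => 1 / z) = Inv.inv := by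
    ext z
    simp
  rw [this]
  exact iter_deriv_inv k (s - 1)

lemma LSeries_residueClass_one_eq {t : ℕ} [NeZero t] {δ : ℝ}
    {G : DirichletCharacter ℂ t → ℂ → ℂ} (hG : ∀ χ, IsRegularPart χ δ (G χ)) {s : ℂ}
    (hs : s ∈ Metric.ball 1 δ) (hre : 1 < s.re) :
    LSeries (fun n => (residueClass (1 : ZMod t) n : ℂ)) s =
      (t.totient : ℂ)⁻¹ * (1 / (s - 1) + ∑ χ, G χ s) := by
  classical
  rw [ArithmeticFunction.vonMangoldt.LSeries_residueClass_eq isUnit_one hre, neg_mul, ← mul_neg,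
    ← Finset.sum_neg_distrib]
  congr 1
  have : ∀ χ ∈ (Finset.univ : Finset (DirichletCharacter ℂ t)),
      -(χ (1 : ZMod t)⁻¹ * (deriv (DirichletCharacter.LFunction χ) s /
        DirichletCharacter.LFunction χ s)) = (if χ = 1 then 1 / (s - 1) else 0) + G χ s := by
    intro χ _
    have h1 : (1 : ZMod t)⁻¹ = 1 := ZMod.inv_one t
    rw [h1, map_one, one_mul, (hG χ).2.2 s hs hre]
  rw [Finset.sum_congr rfl this, Finset.sum_add_distrib, Finset.sum_ite_eq' Finset.univ]
  simp

lemma residueClass_one_derivative_bounds {t : ℕ} [NeZero t] {δ : ℝ}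
    (hreg : ∀ χ : DirichletCharacter ℂ t, ∃ G, IsRegularPart χ δ G)
    {k : ℕ} (hk : t.totient ≤ 2 ^ k) {η : ℝ} (hη : 0 < η) (hηδ : η ≤ δ / 4) :
    Summable (fun n : ℕ => residueClass (1 : ZMod t) n * Real.log n ^ k * (n : ℝ) ^ (-(1 + η))) ∧
    (1 : ℝ) / 2 * ((t.totient : ℝ)⁻¹ * (k.factorial / η ^ (k + 1))) ≤
      ∑' n : ℕ, residueClass (1 : ZMod t) n * Real.log n ^ k * (n : ℝ) ^ (-(1 + η)) ∧
    ∑' n : ℕ, residueClass (1 : ZMod t) n * Real.log n ^ k * (n : ℝ) ^ (-(1 + η)) ≤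
      (3 : ℝ) / 2 * ((t.totient : ℝ)⁻¹ * (k.factorial / η ^ (k + 1))) := by
  choose G hG using hreg
  set E : ℂ → ℂ := fun s => ∑ χ, G χ s with hE
  have hδ : 0 < δ := by linarith
  have hφ : (0 : ℝ) < t.totient := by exact_mod_cast Nat.totient_pos.2 (NeZero.pos t)
  have hEd : DifferentiableOn ℂ E (Metric.ball 1 δ) := by
    have := DifferentiableOn.fun_sum (u := Finset.univ) fun χ _ => (hG χ).1
    exact this
  have hEb : ∀ s ∈ Metric.ball (1 : ℂ) δ, ‖E s‖ ≤ t.totient * (1 / (2 * δ)) := by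
    intro s hs
    refine (norm_sum_le_of_le _ fun χ _ => (hG χ).2.1 s hs).trans ?_
    rw [Finset.sum_const, nsmul_eq_mul, Finset.card_univ, ← Nat.card_eq_fintype_card,
      DirichletCharacter.card_eq_totient_of_hasEnoughRootsOfUnity]
  set s₀ : ℂ := ((1 + η : ℝ) : ℂ) with hs₀
  have hs₀1 : s₀ - 1 = η := by
    rw [hs₀]
    push_cast
    ring
  have hball : Metric.closedBall s₀ (2 * η) ⊆ Metric.ball 1 δ := by
    refine Metric.closedBall_subset_ball' ?_
    rw [dist_eq_norm, hs₀1, Complex.norm_real, Real.norm_of_nonneg hη.le]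
    linarith
  have hs₀ball : s₀ ∈ Metric.ball (1 : ℂ) δ :=
    hball (Metric.mem_closedBall_self (by positivity))
  have hcauchy : ‖iteratedDeriv k E s₀‖ ≤
      k.factorial * (t.totient * (1 / (2 * δ))) / (2 * η) ^ k := by
    refine Complex.norm_iteratedDeriv_le_of_forall_mem_sphere_norm_le k (by positivity) ?_ ?_
    · refine DifferentiableOn.diffContOnCl ?_
      rw [closure_ball _ (by positivity)]
      exact hEd.mono hball
    · exact fun z hz => hEb z (hball (Metric.sphere_subset_closedBall hz))
  have hre : 1 < s₀.re := by
    rw [hs₀, Complex.ofReal_re]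
    linarith
  have hre' : (1 : EReal) < (s₀.re : EReal) := by
    rw [← EReal.coe_one]
    exact EReal.coe_lt_coe_iff.2 hre
  have habs : LSeries.abscissaOfAbsConv (fun n => (residueClass (1 : ZMod t) n : ℂ)) < s₀.re :=
    (ArithmeticFunction.vonMangoldt.abscissaOfAbsConv_residueClass_le_one _).trans_lt
      hre'
  have hterm := LSeries.term_iterate_logMul_ofReal (f := residueClass (1 : ZMod t))
    (ArithmeticFunction.vonMangoldt.residueClass_apply_zero _) k
  have hsum : Summable (fun n : ℕ =>
      residueClass (1 : ZMod t) n * Real.log n ^ k * (n : ℝ) ^ (-(1 + η))) := by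
    have h1 := LSeriesSummable_of_abscissaOfAbsConv_lt_re
      ((LSeries.absicssaOfAbsConv_logPowMul (m := k)).trans_lt habs)
    rw [LSeriesSummable] at h1
    refine Complex.summable_ofReal.1 (h1.congr fun n => ?_)
    exact hterm n _
  set D := ∑' n : ℕ, residueClass (1 : ZMod t) n * Real.log n ^ k * (n : ℝ) ^ (-(1 + η)) with hD
  have hLD : LSeries (LSeries.logMul^[k] fun n => (residueClass (1 : ZMod t) n : ℂ)) s₀ = D := by
    rw [LSeries, hD, Complex.ofReal_tsum]
    exact tsum_congr fun n => hterm n _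
  have hder := LSeries_iteratedDeriv k habs
  have hev : LSeries (fun n => (residueClass (1 : ZMod t) n : ℂ)) =ᶠ[𝓝 s₀]
      fun s => (t.totient : ℂ)⁻¹ * (1 / (s - 1) + E s) := by
    filter_upwards [Metric.isOpen_ball.mem_nhds hs₀ball,
      (isOpen_lt continuous_const Complex.continuous_re).mem_nhds hre] with s hs hs'
    exact LSeries_residueClass_one_eq hG hs hs'
  have hη0 : (η : ℂ) ≠ 0 := by exact_mod_cast hη.ne'
  have hcd1 : ContDiffAt ℂ k (fun s : ℂ => 1 / (s - 1)) s₀ :=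
    contDiffAt_const.div (contDiffAt_id.sub contDiffAt_const) (by simpa [hs₀1] using hη0)
  have hcd2 : ContDiffAt ℂ k E s₀ :=
    (hEd.contDiffOn Metric.isOpen_ball).contDiffAt (Metric.isOpen_ball.mem_nhds hs₀ball)
  rw [hev.iteratedDeriv_eq, iteratedDeriv_const_mul _ (hcd1.add hcd2),
    iteratedDeriv_fun_add hcd1 hcd2, iteratedDeriv_one_div_sub_one, hs₀1, hLD] at hder
  have hpow : (η : ℂ) ^ (-1 - (k : ℤ)) = ((1 / η ^ (k + 1) : ℝ) : ℂ) := by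
    rw [show -1 - (k : ℤ) = -((k + 1 : ℕ) : ℤ) by push_cast; ring, zpow_neg, zpow_natCast]
    push_cast
    rw [one_div]
  rw [hpow] at hder
  have hφ0 : (t.totient : ℂ) ≠ 0 := by exact_mod_cast hφ.ne'
  have hnorm : |t.totient * D - k.factorial / η ^ (k + 1)| = ‖iteratedDeriv k E s₀‖ := by
    have h1 : (((t.totient : ℝ) * D - k.factorial / η ^ (k + 1) : ℝ) : ℂ) =
        (-1) ^ k * iteratedDeriv k E s₀ := by
      have h2 : ((-1 : ℂ) ^ k) * (-1) ^ k = 1 := by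
        rw [← mul_pow]
        simp
      have h3 : (D : ℂ) = (-1) ^ k * ((-1) ^ k * D) := by rw [← mul_assoc, h2, one_mul]
      push_cast
      rw [h3, ← hder]
      push_cast
      field_simp
      linear_combination (k.factorial : ℂ) * h2
    rw [← Real.norm_eq_abs, ← Complex.norm_real, h1, norm_mul, norm_pow, norm_neg, norm_one,
      one_pow, one_mul]
  have hbd : (k.factorial : ℝ) * (t.totient * (1 / (2 * δ))) / (2 * η) ^ k ≤
      1 / 2 * (k.factorial / η ^ (k + 1)) := by
    have h2k : (t.totient : ℝ) ≤ 2 ^ k := by exact_mod_cast hk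
    have hfac : (0 : ℝ) ≤ k.factorial := by positivity
    have h1 : (t.totient : ℝ) * (1 / (2 * δ)) ≤ 2 ^ k * (1 / (2 * η)) := by
      gcongr
      linarith
    calc _ ≤ (k.factorial : ℝ) * (2 ^ k * (1 / (2 * η))) / (2 * η) ^ k := by gcongr
      _ = _ := by
        rw [mul_pow, pow_succ]
        field_simp
  have hfin := abs_le.1 (hnorm.le.trans (hcauchy.trans hbd))
  refine ⟨hsum, ?_, ?_⟩
  · rw [mul_left_comm, inv_mul_le_iff₀ hφ]
    linarith [hfin.1]
  · rw [mul_left_comm, le_inv_mul_iff₀ hφ]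
    linarith [hfin.2]

end DerivativeEstimate

section Concentration

lemma Real.natCast_rpow_neg_one_add {n : ℕ} (hn : n ≠ 0) (η : ℝ) :
    (n : ℝ) ^ (-(1 + η)) = Real.exp (-(η * Real.log n)) / n := by
  have hn0 : (0 : ℝ) < n := by exact_mod_cast Nat.pos_of_ne_zero hn
  rw [neg_add, Real.rpow_add hn0, Real.rpow_neg_one, Real.rpow_def_of_pos hn0, inv_mul_eq_div]
  congr 2
  ring

/-- If the weighted sums `∑ a n * log n ^ k / n ^ (1 + η)` behave like `A * k! / η ^ (k + 1)` up to
a constant factor, then a positive proportion of the mass sits where `log n` is near `U`. -/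
lemma le_sum_of_derivative_bounds {a : ℕ → ℝ} (ha : ∀ n, 0 ≤ a n) {A U τ : ℝ} (hA : 0 < A)
    (hU : 0 < U) (hτ : 0 < τ) (hτ1 : τ < 1) {k : ℕ} (hk : 0 < k)
    (hup : (1 + τ) * ((1 + τ) * Real.exp (-τ)) ^ k ≤ 1 / 12)
    (hlow : (1 - τ) * ((1 - τ) * Real.exp τ) ^ k ≤ 1 / 12)
    (H : ∀ η : ℝ, 0 < η → η ≤ k * (1 + τ) / ((1 - τ) * U) →
      Summable (fun n : ℕ => a n * Real.log n ^ k * (n : ℝ) ^ (-(1 + η))) ∧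
      1 / 2 * (A * (k.factorial / η ^ (k + 1))) ≤
        ∑' n : ℕ, a n * Real.log n ^ k * (n : ℝ) ^ (-(1 + η)) ∧
      ∑' n : ℕ, a n * Real.log n ^ k * (n : ℝ) ^ (-(1 + η)) ≤
        3 / 2 * (A * (k.factorial / η ^ (k + 1))))
    (W : Finset ℕ) (hW : ∀ n : ℕ, n ≠ 0 → (1 - τ) * U / (1 + τ) < Real.log n →
      Real.log n < U → n ∈ W) :
    A * U / (8 * k) ≤ ∑ n ∈ W, a n / n := by
  have hk0 : (0 : ℝ) < k := by exact_mod_cast hk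
  have h1τ : 0 < 1 - τ := by linarith
  have h1τ' : 0 < 1 + τ := by linarith
  set η₁ : ℝ := k / U with hη₁
  set η₂ : ℝ := k * (1 + τ) / ((1 - τ) * U) with hη₂
  set η : ℝ := k * (1 + τ) / U with hη
  have hη₁0 : 0 < η₁ := by positivity
  have hη₂0 : 0 < η₂ := by positivity
  have hη0 : 0 < η := by positivity
  have e1 : η = (1 + τ) * η₁ := by
    rw [hη, hη₁]
    ring
  have e2 : η = (1 - τ) * η₂ := by
    rw [hη, hη₂]
    field_simp
  have l12 : η₁ ≤ η := by nlinarith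
  have l2 : η ≤ η₂ := by nlinarith
  obtain ⟨s1, -, u1⟩ := H η₁ hη₁0 (l12.trans l2)
  obtain ⟨s2, -, u2⟩ := H η₂ hη₂0 le_rfl
  obtain ⟨s0, u0, -⟩ := H η hη0 l2
  set B : ℝ := A * (k.factorial / η ^ (k + 1)) with hB
  have hB0 : 0 < B := by positivity
  have B1 : A * (k.factorial / η₁ ^ (k + 1)) = (1 + τ) ^ (k + 1) * B := by
    rw [hB, e1, mul_pow]
    field_simp
  have B2 : A * (k.factorial / η₂ ^ (k + 1)) = (1 - τ) ^ (k + 1) * B := by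
    rw [hB, e2, mul_pow]
    field_simp
  set g : ℝ → ℕ → ℝ := fun η n => a n * Real.log n ^ k * (n : ℝ) ^ (-(1 + η)) with hg
  have hg0 : ∀ η n, 0 ≤ g η n := fun η n =>
    mul_nonneg (mul_nonneg (ha n) (pow_nonneg (Real.log_natCast_nonneg n) k))
      (Real.rpow_nonneg n.cast_nonneg _)
  have hpt : ∀ n, g η n ≤ (if n ∈ W then g η n else 0) + Real.exp (-(k * τ)) * g η₁ n +
      Real.exp (k * τ) * g η₂ n := by
    intro n
    have p1 : 0 ≤ Real.exp (-(k * τ)) * g η₁ n := mul_nonneg (Real.exp_pos _).le (hg0 _ _)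
    have p2 : 0 ≤ Real.exp (k * τ) * g η₂ n := mul_nonneg (Real.exp_pos _).le (hg0 _ _)
    by_cases hnW : n ∈ W
    · rw [if_pos hnW]
      linarith
    rw [if_neg hnW, zero_add]
    by_cases hn : n = 0
    · have : g η n = 0 := by
        simp only [hg, hn, Nat.cast_zero]
        rw [Real.log_zero, zero_pow hk.ne']
        simp
      rw [this]
      positivity
    have hc : 0 ≤ a n * Real.log n ^ k := mul_nonneg (ha n)
      (pow_nonneg (Real.log_natCast_nonneg n) k)
    rcases le_or_gt U (Real.log n) with h | h
    · have : g η n ≤ Real.exp (-(k * τ)) * g η₁ n := by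
        simp only [hg]
        rw [mul_left_comm]
        refine mul_le_mul_of_nonneg_left ?_ hc
        rw [Real.natCast_rpow_neg_one_add hn, Real.natCast_rpow_neg_one_add hn, ← mul_div_assoc,
          ← Real.exp_add]
        gcongr
        have : k * τ = (η - η₁) * U := by
          rw [hη, hη₁]
          field_simp
          ring
        nlinarith
      linarith
    · have h' : Real.log n ≤ (1 - τ) * U / (1 + τ) := by
        by_contra hcon
        exact hnW (hW n hn (not_le.1 hcon) h)
      have : g η n ≤ Real.exp (k * τ) * g η₂ n := by
        simp only [hg]
        rw [mul_left_comm]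
        refine mul_le_mul_of_nonneg_left ?_ hc
        rw [Real.natCast_rpow_neg_one_add hn, Real.natCast_rpow_neg_one_add hn, ← mul_div_assoc,
          ← Real.exp_add]
        gcongr
        have : k * τ = (η₂ - η) * ((1 - τ) * U / (1 + τ)) := by
          rw [hη, hη₂]
          field_simp
          ring
        nlinarith
      linarith
  have hWsum : HasSum (fun n => if n ∈ W then g η n else 0) (∑ n ∈ W, g η n) := by
    have : HasSum (fun n => if n ∈ W then g η n else 0) (∑ n ∈ W, if n ∈ W then g η n else 0) :=
      hasSum_sum_of_ne_finset_zero fun n hn => if_neg hn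
    rwa [Finset.sum_congr rfl fun n hn => if_pos hn] at this
  have htot := hasSum_le hpt s0.hasSum
    ((hWsum.add (s1.hasSum.mul_left _)).add (s2.hasSum.mul_left _))
  have t1 : Real.exp (-(k * τ)) * ∑' n, g η₁ n ≤ 1 / 8 * B := by
    calc _ ≤ Real.exp (-(k * τ)) * (3 / 2 * ((1 + τ) ^ (k + 1) * B)) := by
          gcongr
          exact B1 ▸ u1
      _ = 3 / 2 * ((1 + τ) * ((1 + τ) * Real.exp (-τ)) ^ k) * B := by
          rw [show -(k * τ) = k * (-τ) by ring, Real.exp_nat_mul, mul_pow]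
          ring
      _ ≤ 3 / 2 * (1 / 12) * B := by gcongr
      _ = 1 / 8 * B := by ring
  have t2 : Real.exp (k * τ) * ∑' n, g η₂ n ≤ 1 / 8 * B := by
    calc _ ≤ Real.exp (k * τ) * (3 / 2 * ((1 - τ) ^ (k + 1) * B)) := by
          gcongr
          exact B2 ▸ u2
      _ = 3 / 2 * ((1 - τ) * ((1 - τ) * Real.exp τ) ^ k) * B := by
          rw [Real.exp_nat_mul, mul_pow]
          ring
      _ ≤ 3 / 2 * (1 / 12) * B := by gcongr
      _ = 1 / 8 * B := by ring
  have hlow' : 1 / 4 * B ≤ ∑ n ∈ W, g η n := by linarith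
  have hupp : ∑ n ∈ W, g η n ≤ k.factorial / η ^ k * ∑ n ∈ W, a n / n := by
    rw [Finset.mul_sum]
    refine Finset.sum_le_sum fun n _ => ?_
    by_cases hn : n = 0
    · simp only [hg, hn, Nat.cast_zero]
      rw [Real.log_zero, zero_pow hk.ne']
      simp
    have hL := Real.log_natCast_nonneg n
    simp only [hg]
    rw [Real.natCast_rpow_neg_one_add hn]
    have h3 : Real.log n ^ k * Real.exp (-(η * Real.log n)) ≤ k.factorial / η ^ k := by
      have h4 := Real.pow_div_factorial_le_exp (η * Real.log n) (by positivity) k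
      rw [div_le_iff₀ (by positivity), mul_pow] at h4
      rw [le_div_iff₀ (by positivity), Real.exp_neg, ← div_eq_mul_inv, div_mul_eq_mul_div,
        div_le_iff₀ (Real.exp_pos _)]
      linarith
    calc a n * Real.log n ^ k * (Real.exp (-(η * Real.log n)) / n) =
        (Real.log n ^ k * Real.exp (-(η * Real.log n))) * (a n / n) := by ring
      _ ≤ _ := by
        gcongr
        exact div_nonneg (ha n) n.cast_nonneg
  have hS := hlow'.trans hupp
  have hfac : (0 : ℝ) < k.factorial / η ^ k := by positivity
  have hBe : 1 / 4 * B = k.factorial / η ^ k * (A / (4 * η)) := by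
    rw [hB, pow_succ]
    field_simp
  rw [hBe] at hS
  refine le_trans ?_ (le_of_mul_le_mul_left hS hfac)
  rw [hη, div_le_div_iff₀ (by positivity) (by positivity)]
  have : 4 * (k * (1 + τ) / U) = 4 * k * (1 + τ) / U := by ring
  rw [this, mul_div_assoc']
  rw [div_le_iff₀ hU]
  have : A * U * (4 * k * (1 + τ)) ≤ A * U * (4 * k * 2) := by gcongr; linarith
  linarith

end Concentration

section PrimesInProgressions

open ArithmeticFunction.vonMangoldt (residueClass)
open ArithmeticFunction (vonMangoldt)

lemma eventually_concentration_bounds {τ : ℝ} (hτ : 0 < τ) (hτ1 : τ < 1) :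
    ∀ᶠ k : ℕ in atTop, (1 + τ) * ((1 + τ) * Real.exp (-τ)) ^ k ≤ 1 / 12 ∧
      (1 - τ) * ((1 - τ) * Real.exp τ) ^ k ≤ 1 / 12 := by
  have aux : ∀ c x : ℝ, 0 ≤ x → x < 1 → ∀ᶠ k : ℕ in atTop, c * x ^ k ≤ 1 / 12 := by
    intro c x hx hx1
    have h := (tendsto_pow_atTop_nhds_zero_of_lt_one hx hx1).const_mul c
    rw [mul_zero] at h
    exact h.eventually_le_const (by norm_num)
  refine (aux _ _ (by positivity) ?_).and (aux _ _ ?_ ?_)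
  · rw [Real.exp_neg, mul_inv_lt_iff₀ (Real.exp_pos _), one_mul]
    linarith [Real.add_one_lt_exp hτ.ne']
  · exact mul_nonneg (by linarith) (Real.exp_pos _).le
  · have h := Real.add_one_lt_exp (neg_ne_zero.2 hτ.ne')
    rw [Real.exp_neg, ← one_div, lt_div_iff₀ (Real.exp_pos _)] at h
    linarith

lemma eventually_le_sum_residueClass (r : ℕ) [NeZero r] (hr : Odd r) {τ : ℝ} (hτ : 0 < τ)
    (hτ1 : τ < 1) :
    ∀ᶠ K : ℕ in atTop, ∀ U : ℝ, (K : ℝ) ^ 12 ≤ U → ∀ t : ℕ, r ∣ t → t ∣ r ^ (K + 1) →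
      ∀ W : Finset ℕ, (∀ n : ℕ, n ≠ 0 → (1 - τ) * U / (1 + τ) < Real.log n →
        Real.log n < U → n ∈ W) →
      U / (16 * r * K * t) ≤ ∑ n ∈ W, residueClass (1 : ZMod t) n / n := by
  obtain ⟨δ₀, hδ₀, hreg⟩ := exists_forall_isRegularPart r
  have hr0 : 0 < r := NeZero.pos r
  have hr1 : (1 : ℝ) ≤ r := by exact_mod_cast hr0
  have h1τ : 0 < 1 - τ := by linarith
  set C : ℝ := 8 * r * (1 + τ) / (1 - τ) with hC
  have hC0 : 0 < C := by positivity
  have hk : Tendsto (fun K : ℕ => 2 * r * K) atTop atTop :=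
    tendsto_id.const_mul_atTop' (by positivity)
  filter_upwards [hk.eventually (eventually_concentration_bounds hτ hτ1), eventually_ge_atTop 1,
    tendsto_natCast_atTop_atTop.eventually_gt_atTop (C / δ₀),
    tendsto_natCast_atTop_atTop.eventually_ge_atTop (C * (2 ^ 25 * (3 + 2 * r) ^ 9))]
    with K hconc hK1 hKδ₀ hKbig U hU t hrt htr W hW
  have hr' : 0 < r ^ (K + 1) := pow_pos hr0 _
  have htle : t ≤ r ^ (K + 1) := Nat.le_of_dvd hr' htr
  have ht0 : 0 < t := Nat.pos_of_dvd_of_pos htr hr'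
  have : NeZero t := ⟨ht0.ne'⟩
  have hpf : t.primeFactors = r.primeFactors := by
    refine subset_antisymm ?_ (Nat.primeFactors_mono hrt ht0.ne')
    have := Nat.primeFactors_mono htr hr'.ne'
    rwa [Nat.primeFactors_pow _ (Nat.succ_ne_zero K)] at this
  have htodd : Odd t := Odd.of_dvd_nat hr.pow htr
  have hK1' : (1 : ℝ) ≤ K := by exact_mod_cast hK1
  have hU0 : 0 < U := lt_of_lt_of_le (by positivity) hU
  set δ : ℝ := 4 * ((2 * r * K : ℕ) * (1 + τ) / ((1 - τ) * U)) with hδ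
  have hδ0 : 0 < δ := by
    have : (0 : ℝ) < (2 * r * K : ℕ) := by
      push_cast
      positivity
    positivity
  have hδC : δ ≤ C / K ^ 11 := by
    calc δ = C * K / U := by
          rw [hδ, hC]
          push_cast
          field_simp
          ring
      _ ≤ C * K / K ^ 12 := by gcongr
      _ = C / K ^ 11 := by
          field_simp
  have hδδ₀ : δ < δ₀ := by
    refine hδC.trans_lt ?_
    rw [div_lt_iff₀ (by positivity), mul_comm]
    rw [div_lt_iff₀ hδ₀] at hKδ₀
    refine hKδ₀.trans_le ?_
    gcongr
    exact le_self_pow₀ hK1' (by norm_num)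
  have hδlog : δ ≤ 1 / (2 ^ 25 * (3 + Real.log t) ^ 9) := by
    have ht1 : (1 : ℝ) ≤ t := by exact_mod_cast ht0
    have hlog0 := Real.log_nonneg ht1
    have hlog : 3 + Real.log t ≤ K * (3 + 2 * r) := by
      have h1 : Real.log t ≤ (K + 1) * Real.log r := by
        have h2 : Real.log t ≤ Real.log ((r : ℝ) ^ (K + 1)) :=
          Real.log_le_log (by linarith) (by exact_mod_cast htle)
        rw [Real.log_pow] at h2
        exact_mod_cast h2
      have h3 : Real.log r ≤ r := Real.log_le_self (by positivity)
      have h4 : (K + 1 : ℝ) * Real.log r ≤ (K + 1) * r := by gcongr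
      nlinarith
    refine hδC.trans ?_
    rw [div_le_div_iff₀ (by positivity) (by positivity), one_mul]
    calc C * (2 ^ 25 * (3 + Real.log t) ^ 9) ≤ C * (2 ^ 25 * (K * (3 + 2 * r)) ^ 9) := by gcongr
      _ = C * (2 ^ 25 * (3 + 2 * r) ^ 9) * K ^ 9 := by ring
      _ ≤ K * K ^ 9 := by gcongr
      _ = K ^ 10 := by ring
      _ ≤ K ^ 11 := pow_le_pow_right₀ hK1' (by norm_num)
  have hφ : t.totient ≤ 2 ^ (2 * r * K) := by
    calc t.totient ≤ t := Nat.totient_le t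
      _ ≤ r ^ (K + 1) := htle
      _ ≤ (2 ^ r) ^ (K + 1) := by
        gcongr
        exact Nat.lt_two_pow_self.le
      _ = 2 ^ (r * (K + 1)) := by rw [pow_mul]
      _ ≤ 2 ^ (2 * r * K) := Nat.pow_le_pow_right (by norm_num) (by nlinarith)
  have hφ0 : (0 : ℝ) < t.totient := by exact_mod_cast Nat.totient_pos.2 ht0
  have hmain := le_sum_of_derivative_bounds
    (ArithmeticFunction.vonMangoldt.residueClass_nonneg (1 : ZMod t)) (inv_pos.2 hφ0) hU0 hτ hτ1
    (k := 2 * r * K) (by positivity) hconc.1 hconc.2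
    (fun η hη hη' => residueClass_one_derivative_bounds
      (hreg t hrt htodd hpf δ hδ0 hδδ₀ hδlog) hφ hη (by rw [hδ]; linarith)) W hW
  refine le_trans ?_ hmain
  push_cast
  rw [div_le_div_iff₀ (by positivity) (by positivity)]
  have hφt : (t.totient : ℝ) ≤ t := by exact_mod_cast Nat.totient_le t
  have h5 : 1 ≤ (t.totient : ℝ)⁻¹ * t := by rwa [le_inv_mul_iff₀ hφ0, mul_one]
  calc U * (8 * (2 * r * K)) = 16 * r * K * U * 1 := by ring
    _ ≤ 16 * r * K * U * ((t.totient : ℝ)⁻¹ * t) := by gcongr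
    _ = _ := by ring

end PrimesInProgressions

section PrimesInWindow

open ArithmeticFunction.vonMangoldt (residueClass)
open ArithmeticFunction (vonMangoldt)

/-- The primes `p` with `V < log p < U`. -/
noncomputable def windowPrimes (V U : ℝ) : Finset ℕ :=
  {n ∈ Finset.Ioc 0 ⌊Real.exp U⌋₊ | n.Prime ∧ V < Real.log n ∧ Real.log n < U}

lemma mem_windowPrimes {V U : ℝ} {n : ℕ} :
    n ∈ windowPrimes V U ↔ n.Prime ∧ V < Real.log n ∧ Real.log n < U := by
  rw [windowPrimes, Finset.mem_filter, and_iff_right_iff_imp, Finset.mem_Ioc]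
  rintro ⟨hn, -, hU⟩
  refine ⟨hn.pos, Nat.le_floor ?_⟩
  rw [← Real.exp_log (Nat.cast_pos.2 hn.pos)]
  exact Real.exp_le_exp.2 hU.le

lemma sum_residueClass_le {V U : ℝ} (hU : 0 ≤ U) (t : ℕ) :
    ∑ n ∈ Finset.Ioc 0 ⌊Real.exp U⌋₊ with V < Real.log ((n : ℕ) : ℝ) ∧ Real.log n < U,
      residueClass (1 : ZMod t) n / n ≤
    ∑ p ∈ windowPrimes V U with t ∣ p - 1, Real.log p / p +
      2 * U * Real.exp (U / 2 - V) := by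
  rw [← Finset.sum_filter_add_sum_filter_not _ Nat.Prime]
  refine add_le_add (le_of_eq ?_) ?_
  · rw [windowPrimes, Finset.filter_filter, Finset.filter_filter, Finset.sum_filter,
      Finset.sum_filter]
    refine Finset.sum_congr rfl fun n _ => ?_
    by_cases hn : n.Prime
    · have h1 : (n : ZMod t) = 1 ↔ t ∣ n - 1 := by
        rw [← Nat.cast_one, eq_comm, ZMod.natCast_eq_natCast_iff, Nat.modEq_iff_dvd' hn.one_le]
      by_cases ht : t ∣ n - 1
      · simp [hn, ht, h1.2 ht, residueClass, ArithmeticFunction.vonMangoldt_apply_prime hn]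
      · simp [hn, ht, h1.not.2 ht, residueClass]
    · simp [hn]
  · have hψ := Chebyshev.psi_sub_theta_le (Real.one_le_exp hU)
    rw [Chebyshev.psi_sub_theta_eq_sum_not_prime, Real.log_exp, ← Real.exp_half] at hψ
    calc _ ≤ ∑ n ∈ Finset.Ioc 0 ⌊Real.exp U⌋₊ with ¬ n.Prime,
          vonMangoldt n * Real.exp (-V) := by
          refine (Finset.sum_le_sum fun n hn => ?_).trans
            (Finset.sum_le_sum_of_subset_of_nonneg
              (Finset.filter_subset_filter _ (Finset.filter_subset _ _)) fun n _ _ =>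
              mul_nonneg ArithmeticFunction.vonMangoldt_nonneg (Real.exp_pos _).le)
          simp only [Finset.mem_filter, Finset.mem_Ioc] at hn
          have hn0 : (0 : ℝ) < n := Nat.cast_pos.2 hn.1.1.1
          rw [div_eq_mul_inv]
          have h1 : residueClass (1 : ZMod t) n ≤ vonMangoldt n :=
            Set.indicator_apply_le' (fun _ => le_rfl)
              fun _ => ArithmeticFunction.vonMangoldt_nonneg
          have h2 : (n : ℝ)⁻¹ ≤ Real.exp (-V) := by
            rw [Real.exp_neg, inv_le_inv₀ hn0 (Real.exp_pos _), ← Real.le_log_iff_exp_le hn0]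
            exact hn.1.2.1.le
          exact mul_le_mul h1 h2 (by positivity) ArithmeticFunction.vonMangoldt_nonneg
      _ = (∑ n ∈ Finset.Ioc 0 ⌊Real.exp U⌋₊ with ¬ n.Prime, vonMangoldt n) * Real.exp (-V) := by
          rw [Finset.sum_mul]
      _ ≤ 2 * Real.exp (U / 2) * U * Real.exp (-V) := by gcongr
      _ = 2 * U * Real.exp (U / 2 - V) := by
          rw [sub_eq_add_neg, Real.exp_add]
          ring

lemma eventually_le_sum_windowPrimes (r : ℕ) [NeZero r] (hr : Odd r) {τ : ℝ} (hτ : 0 < τ)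
    (hτ1 : τ < 1 / 3) :
    ∀ᶠ K : ℕ in atTop, ∀ U : ℝ, (K : ℝ) ^ 12 ≤ U → ∀ t : ℕ, r ∣ t → t ∣ r ^ (K + 1) →
      U / (32 * r * K * t) ≤
        ∑ p ∈ windowPrimes ((1 - τ) * U / (1 + τ)) U with t ∣ p - 1, Real.log p / p := by
  have hr0 : 0 < r := NeZero.pos r
  have hr1 : (1 : ℝ) ≤ r := by exact_mod_cast hr0
  set c : ℝ := (1 - τ) / (1 + τ) - 1 / 2 with hc
  have hc0 : 0 < c := by
    rw [hc, sub_pos, div_lt_div_iff₀ (by norm_num) (by linarith)]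
    linarith
  filter_upwards [eventually_le_sum_residueClass r hr hτ (by linarith), eventually_ge_atTop 1,
    tendsto_natCast_atTop_atTop.eventually_ge_atTop (68 * r / c)]
    with K hK hK1 hKc U hU t hrt htr
  have hK1' : (1 : ℝ) ≤ K := by exact_mod_cast hK1
  have hU0 : 0 < U := lt_of_lt_of_le (by positivity) hU
  have hr' : 0 < r ^ (K + 1) := pow_pos hr0 _
  have htle : (t : ℝ) ≤ (r : ℝ) ^ (K + 1) := by exact_mod_cast Nat.le_of_dvd hr' htr
  have ht0 : (0 : ℝ) < t := by exact_mod_cast Nat.pos_of_dvd_of_pos htr hr'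
  have h1 := hK U hU t hrt htr
    {n ∈ Finset.Ioc 0 ⌊Real.exp U⌋₊ | (1 - τ) * U / (1 + τ) < Real.log ((n : ℕ) : ℝ) ∧
      Real.log n < U} (by
      intro n hn hl hu
      rw [Finset.mem_filter, Finset.mem_Ioc]
      refine ⟨⟨Nat.pos_of_ne_zero hn, Nat.le_floor ?_⟩, hl, hu⟩
      rw [← Real.exp_log (Nat.cast_pos.2 (Nat.pos_of_ne_zero hn))]
      exact Real.exp_le_exp.2 hu.le)
  have h2 := h1.trans (sum_residueClass_le hU0.le t)
  have hself : ∀ x : ℝ, x ≤ Real.exp x := fun x => by linarith [Real.add_one_le_exp x]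
  have h3 : 64 * r * K * t * Real.exp (U / 2 - (1 - τ) * U / (1 + τ)) ≤ 1 := by
    have h4 : U / 2 - (1 - τ) * U / (1 + τ) = -(c * U) := by
      rw [hc]
      ring
    have h5 : 68 * r * K ≤ c * U := by
      rw [div_le_iff₀ hc0] at hKc
      calc 68 * r * K ≤ K * c * K := by gcongr
        _ = c * K ^ 2 := by ring
        _ ≤ c * K ^ 12 := by
          gcongr
          norm_num
        _ ≤ c * U := by gcongr
    have h6 : 64 * r * K * t ≤ Real.exp (68 * r * K) := by
      calc 64 * r * K * t ≤ Real.exp 64 * Real.exp r * Real.exp K * (Real.exp r) ^ (K + 1) := by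
            gcongr
            · exact hself _
            · exact hself _
            · exact hself _
            · refine htle.trans ?_
              gcongr
              exact hself _
        _ = Real.exp (64 + r + K + (K + 1) * r) := by
            rw [Real.exp_add, Real.exp_add, Real.exp_add, ← Real.exp_nat_mul]
            push_cast
            rfl
        _ ≤ Real.exp (68 * r * K) := by
            rw [Real.exp_le_exp]
            nlinarith
    calc _ ≤ Real.exp (68 * r * K) * Real.exp (-(68 * r * K)) := by
          rw [h4]
          gcongr
      _ = 1 := by
          rw [← Real.exp_add, add_neg_cancel, Real.exp_zero]
  have h7 : 2 * U * Real.exp (U / 2 - (1 - τ) * U / (1 + τ)) ≤ U / (32 * r * K * t) := by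
    rw [le_div_iff₀ (by positivity)]
    calc _ = U * (64 * r * K * t * Real.exp (U / 2 - (1 - τ) * U / (1 + τ))) := by ring
      _ ≤ U * 1 := by gcongr
      _ = U := mul_one U
  have h8 : U / (16 * r * K * t) = U / (32 * r * K * t) + U / (32 * r * K * t) := by
    field_simp
    norm_num
  linarith

end PrimesInWindow

section Pigeonhole

lemma rad_totient_mul_dvd {p q : ℕ} (hp : p.Prime) (hq : q.Prime) (hpq : p ≠ q)
    (h : (p - 1).primeFactors = (q - 1).primeFactors) :
    rad (Nat.totient (p * q)) ∣ p * q - 1 := by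
  have hp1 : p - 1 ≠ 0 := Nat.sub_ne_zero_of_lt hp.one_lt
  have hq1 : q - 1 ≠ 0 := Nat.sub_ne_zero_of_lt hq.one_lt
  rw [Nat.totient_mul ((Nat.coprime_primes hp hq).2 hpq), Nat.totient_prime hp,
    Nat.totient_prime hq, rad, Nat.primeFactors_mul hp1 hq1, ← h, Finset.union_self]
  have h1 : ∏ x ∈ (p - 1).primeFactors, x ∣ p - 1 := Nat.prod_primeFactors_dvd _
  have h2 : ∏ x ∈ (p - 1).primeFactors, x ∣ q - 1 := h ▸ Nat.prod_primeFactors_dvd _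
  have h3 : p * q - 1 = (p - 1) * q + (q - 1) := by
    obtain ⟨a, rfl⟩ := Nat.exists_eq_add_of_lt hp.one_lt
    obtain ⟨b, rfl⟩ := Nat.exists_eq_add_of_lt hq.one_lt
    simp only [Nat.add_sub_cancel]
    rw [Nat.sub_eq_iff_eq_add (by nlinarith)]
    ring
  rw [h3]
  exact dvd_add (h1.mul_right q) h2

lemma inv_le_sum_inv {P : Finset ℕ} {U c : ℝ} (hU : 0 < U) (hc : 0 < c)
    (hP : ∀ p ∈ P, p.Prime ∧ Real.log p ≤ U) {t : ℕ} (ht : 0 < t)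
    (hsum : U / (c * t) ≤ ∑ p ∈ P with t ∣ p - 1, Real.log p / p) :
    c⁻¹ ≤ ∑ m ∈ Finset.Icc 1 ⌊Real.exp U⌋₊ with t * m + 1 ∈ P, (m : ℝ)⁻¹ := by
  have ht0 : (0 : ℝ) < t := Nat.cast_pos.2 ht
  have hm : ∀ p ∈ P, t ∣ p - 1 → t * ((p - 1) / t) + 1 = p := fun p hp htp => by
    rw [Nat.mul_div_cancel' htp, Nat.sub_add_cancel (hP p hp).1.one_le]
  have hm0 : ∀ p ∈ P, t ∣ p - 1 → 0 < (p - 1) / t := fun p hp htp =>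
    Nat.div_pos (Nat.le_of_dvd (Nat.sub_pos_of_lt (hP p hp).1.one_lt) htp) ht
  have hbij : ∑ p ∈ P with t ∣ p - 1, (((p - 1) / t : ℕ) : ℝ)⁻¹ =
      ∑ m ∈ Finset.Icc 1 ⌊Real.exp U⌋₊ with t * m + 1 ∈ P, (m : ℝ)⁻¹ := by
    refine Finset.sum_nbij' (fun p => (p - 1) / t) (fun m => t * m + 1) ?_ ?_ ?_ ?_ ?_
    · intro p hp
      rw [Finset.mem_filter] at hp
      rw [Finset.mem_filter, Finset.mem_Icc, hm p hp.1 hp.2]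
      refine ⟨⟨hm0 p hp.1 hp.2, Nat.le_floor ?_⟩, hp.1⟩
      have hpp := (hP p hp.1).1
      have h1 : (((p - 1) / t : ℕ) : ℝ) ≤ p := by
        exact_mod_cast (Nat.div_le_self _ _).trans (Nat.sub_le _ _)
      refine h1.trans ?_
      rw [← Real.exp_log (Nat.cast_pos.2 hpp.pos)]
      exact Real.exp_le_exp.2 (hP p hp.1).2
    · intro m hmm
      rw [Finset.mem_filter] at hmm ⊢
      exact ⟨hmm.2, by simp⟩
    · intro p hp
      rw [Finset.mem_filter] at hp
      exact hm p hp.1 hp.2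
    · intro m _
      simp [ht]
    · intro p _
      rfl
  rw [← hbij]
  have h2 : ∑ p ∈ P with t ∣ p - 1, Real.log p / p ≤
      ∑ p ∈ P with t ∣ p - 1, U / t * (((p - 1) / t : ℕ) : ℝ)⁻¹ := by
    refine Finset.sum_le_sum fun p hp => ?_
    rw [Finset.mem_filter] at hp
    have h3 : (0 : ℝ) < ((p - 1) / t : ℕ) := Nat.cast_pos.2 (hm0 p hp.1 hp.2)
    have h4 : (t : ℝ) * ((p - 1) / t : ℕ) ≤ p := by
      exact_mod_cast (Nat.le_succ _).trans (hm p hp.1 hp.2).le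
    rw [← div_eq_mul_inv, div_div]
    exact div_le_div₀ hU.le (hP p hp.1).2 (by positivity) h4
  rw [← Finset.mul_sum] at h2
  have h5 : U / (c * t) = U / t * c⁻¹ := by
    field_simp
  rw [h5] at hsum
  exact le_of_mul_le_mul_left (hsum.trans h2) (by positivity)

lemma sum_Icc_inv_le {U : ℝ} (hU : 0 ≤ U) :
    ∑ m ∈ Finset.Icc 1 ⌊Real.exp U⌋₊, (m : ℝ)⁻¹ ≤ 1 + U := by
  have h := harmonic_le_one_add_log ⌊Real.exp U⌋₊
  rw [harmonic_eq_sum_Icc] at h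
  push_cast at h
  refine h.trans ?_
  gcongr
  have h1 : 0 < ⌊Real.exp U⌋₊ := Nat.floor_pos.2 (Real.one_le_exp hU)
  rw [Real.log_le_iff_le_exp (Nat.cast_pos.2 h1)]
  exact Nat.floor_le (Real.exp_pos _).le

lemma le_mul_card_multiples {T P : Finset ℕ} {B : ℕ} {U c w : ℝ} (hU : 0 < U) (hc : 0 < c)
    (hw : 2 ≤ w) (hP : ∀ p ∈ P, p.Prime ∧ w ≤ p ∧ Real.log p ≤ U)
    (hT : ∀ t ∈ T, 0 < t ∧ t ≤ B)
    (hsum : ∀ t ∈ T, U / (c * t) ≤ ∑ p ∈ P with t ∣ p - 1, Real.log p / p)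
    (hcard : c * (2 + U) ≤ T.card) :
    w ≤ 2 * B * T.card *
      (Finset.card {m ∈ Finset.Icc 1 ⌊Real.exp U⌋₊ | 1 < Finset.card {t ∈ T | t * m + 1 ∈ P}}) := by
  set f : ℕ → ℕ := fun m => Finset.card {t ∈ T | t * m + 1 ∈ P} with hf
  have h1 : T.card * c⁻¹ ≤ ∑ m ∈ Finset.Icc 1 ⌊Real.exp U⌋₊, f m * (m : ℝ)⁻¹ := by
    calc T.card * c⁻¹ = ∑ t ∈ T, c⁻¹ := by rw [Finset.sum_const, nsmul_eq_mul]
      _ ≤ ∑ t ∈ T, ∑ m ∈ Finset.Icc 1 ⌊Real.exp U⌋₊ with t * m + 1 ∈ P, (m : ℝ)⁻¹ :=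
        Finset.sum_le_sum fun t ht => inv_le_sum_inv hU hc
          (fun p hp => ⟨(hP p hp).1, (hP p hp).2.2⟩) (hT t ht).1 (hsum t ht)
      _ = _ := by
        simp_rw [Finset.sum_filter]
        rw [Finset.sum_comm]
        refine Finset.sum_congr rfl fun m _ => ?_
        rw [← Finset.sum_filter, Finset.sum_const, nsmul_eq_mul]
  have hw0 : 0 < w := by linarith
  have h2 : ∀ m ∈ Finset.Icc 1 ⌊Real.exp U⌋₊, f m * (m : ℝ)⁻¹ ≤
      (m : ℝ)⁻¹ + if 1 < f m then T.card * (2 * B / w) else 0 := by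
    intro m hm
    have hm0 : (0 : ℝ) < m := Nat.cast_pos.2 (Finset.mem_Icc.1 hm).1
    split_ifs with hfm
    · obtain ⟨t, ht⟩ := Finset.card_pos.1 (zero_lt_one.trans hfm)
      rw [Finset.mem_filter] at ht
      have h3 := (hP _ ht.2).2.1
      push_cast at h3
      have h4 : (t : ℝ) ≤ B := by exact_mod_cast (hT t ht.1).2
      have h5 : (t : ℝ) * m ≤ B * m := by gcongr
      have h6 : (m : ℝ)⁻¹ ≤ 2 * B / w := by
        rw [inv_le_iff_one_le_mul₀ hm0, div_mul_eq_mul_div, le_div_iff₀ hw0]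
        linarith
      have h7 : (f m : ℝ) ≤ T.card := by exact_mod_cast Finset.card_filter_le _ _
      have : f m * (m : ℝ)⁻¹ ≤ T.card * (2 * B / w) := by gcongr
      have : 0 < (m : ℝ)⁻¹ := by positivity
      linarith
    · rw [add_zero]
      have : (f m : ℝ) ≤ 1 := by exact_mod_cast not_lt.1 hfm
      exact mul_le_of_le_one_left (by positivity) this
  have h3 := h1.trans (Finset.sum_le_sum h2)
  rw [Finset.sum_add_distrib, ← Finset.sum_filter, Finset.sum_const, nsmul_eq_mul] at h3
  have h4 := sum_Icc_inv_le hU.le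
  have h5 : 2 + U ≤ T.card * c⁻¹ := by
    rw [← div_eq_mul_inv, le_div_iff₀ hc]
    linarith
  set g := Finset.card {m ∈ Finset.Icc 1 ⌊Real.exp U⌋₊ | 1 < f m}
  have h6 : 1 ≤ g * (T.card * (2 * B / w)) := by linarith
  calc w = w * 1 := (mul_one w).symm
    _ ≤ w * (g * (T.card * (2 * B / w))) := by gcongr
    _ = _ := by
      field_simp

lemma le_mul_card_radimichael {T P : Finset ℕ} {B : ℕ} {U c w x : ℝ} (hU : 0 < U) (hc : 0 < c)
    (hw : 2 ≤ w) (hP : ∀ p ∈ P, p.Prime ∧ w ≤ p ∧ Real.log p ≤ U)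
    (hT : ∀ t ∈ T, 0 < t ∧ t ≤ B) {S : Finset ℕ} (hS : ∀ t ∈ T, t.primeFactors = S)
    (hsum : ∀ t ∈ T, U / (c * t) ≤ ∑ p ∈ P with t ∣ p - 1, Real.log p / p)
    (hcard : c * (2 + U) ≤ T.card) (hx : Real.exp (2 * U) ≤ x) :
    w ≤ 2 * B * (T.card : ℝ) ^ 2 * Nat.card {n : ℕ | (n : ℝ) ≤ x ∧ 1 < n ∧ ¬ n.Prime ∧
          rad (Nat.totient n) ∣ n - 1} := by
  set R : Set ℕ := {n : ℕ | (n : ℝ) ≤ x ∧ 1 < n ∧ ¬ n.Prime ∧ rad (Nat.totient n) ∣ n - 1}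
  have hRfin : R.Finite := (Set.finite_Iic ⌊x⌋₊).subset fun n hn => Nat.le_floor hn.1
  refine (le_mul_card_multiples hU hc hw hP hT hsum hcard).trans ?_
  set M := {m ∈ Finset.Icc 1 ⌊Real.exp U⌋₊ | 1 < Finset.card {t ∈ T | t * m + 1 ∈ P}}
  have hle : ∀ p ∈ P, (p : ℝ) ≤ Real.exp U := fun p hp =>
    (Real.log_le_iff_le_exp (Nat.cast_pos.2 (hP p hp).1.pos)).1 (hP p hp).2.2
  have hpair : ∀ m ∈ M, ∀ t ∈ T, ∀ t' ∈ T, t * m + 1 ∈ P → t' * m + 1 ∈ P → t < t' →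
      ∃ n ∈ R, ∃ t ∈ T, n.minFac = t * m + 1 := by
    intro m hm t ht t' ht' hp hq htt'
    have hm0 : 0 < m := (Finset.mem_Icc.1 (Finset.mem_filter.1 hm).1).1
    have hpp := (hP _ hp).1
    have hqp := (hP _ hq).1
    have hlt : t * m + 1 < t' * m + 1 := by gcongr
    refine ⟨(t * m + 1) * (t' * m + 1), ⟨?_, ?_, ?_, ?_⟩, t, ht, ?_⟩
    · rw [Nat.cast_mul]
      refine le_trans ?_ hx
      rw [two_mul, Real.exp_add]
      exact mul_le_mul (hle _ hp) (hle _ hq) (Nat.cast_nonneg _) (Real.exp_pos _).le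
    · exact Nat.one_lt_mul_iff.2 ⟨hpp.pos, hqp.pos, Or.inl hpp.one_lt⟩
    · exact Nat.not_prime_mul hpp.ne_one hqp.ne_one
    · refine rad_totient_mul_dvd hpp hqp hlt.ne ?_
      rw [Nat.add_sub_cancel, Nat.add_sub_cancel, Nat.primeFactors_mul (hT t ht).1.ne' hm0.ne',
        Nat.primeFactors_mul (hT t' ht').1.ne' hm0.ne', hS t ht, hS t' ht']
    · refine le_antisymm (Nat.minFac_le_of_dvd hpp.two_le (dvd_mul_right _ _)) ?_
      have hn1 : (t * m + 1) * (t' * m + 1) ≠ 1 :=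
        (Nat.one_lt_mul_iff.2 ⟨hpp.pos, hqp.pos, Or.inl hpp.one_lt⟩).ne'
      have hmf := Nat.minFac_prime hn1
      rcases (Nat.Prime.dvd_mul hmf).1 (Nat.minFac_dvd _) with h | h
      · exact ((Nat.prime_dvd_prime_iff_eq hmf hpp).1 h).ge
      · rw [(Nat.prime_dvd_prime_iff_eq hmf hqp).1 h]
        exact hlt.le
  have hex : ∀ m : ℕ, ∃ n, m ∈ M → n ∈ R ∧ ∃ t ∈ T, n.minFac = t * m + 1 := by
    intro m
    by_cases hm : m ∈ M
    · obtain ⟨t, ht, t', ht', hne⟩ := Finset.one_lt_card.1 (Finset.mem_filter.1 hm).2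
      rw [Finset.mem_filter] at ht ht'
      rcases lt_or_gt_of_ne hne with h | h
      · obtain ⟨n, hn⟩ := hpair m hm t ht.1 t' ht'.1 ht.2 ht'.2 h
        exact ⟨n, fun _ => hn⟩
      · obtain ⟨n, hn⟩ := hpair m hm t' ht'.1 t ht.1 ht'.2 ht.2 h
        exact ⟨n, fun _ => hn⟩
    · exact ⟨0, fun h => absurd h hm⟩
  choose F hF using hex
  have hfib : M.card ≤ T.card * (Finset.image F M).card := by
    refine Finset.card_le_mul_card_image M T.card fun n _ => ?_
    refine (Finset.card_le_card (t := T.image fun t => (n.minFac - 1) / t) ?_).trans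
      Finset.card_image_le
    intro m hm
    rw [Finset.mem_filter] at hm
    obtain ⟨-, t, ht, hmin⟩ := hF m hm.1
    rw [hm.2] at hmin
    refine Finset.mem_image.2 ⟨t, ht, ?_⟩
    rw [hmin, Nat.add_sub_cancel, Nat.mul_div_cancel_left _ (hT t ht).1]
  have himg : (Finset.image F M).card ≤ Nat.card R := by
    rw [Nat.card_coe_set_eq, ← Set.ncard_coe_finset]
    refine Set.ncard_le_ncard ?_ hRfin
    intro n hn
    obtain ⟨m, hm, rfl⟩ := Finset.mem_image.1 (Finset.mem_coe.1 hn)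
    exact (hF m hm).1
  have hM : (M.card : ℝ) ≤ T.card * Nat.card R := by
    exact_mod_cast hfib.trans (Nat.mul_le_mul_left _ himg)
  calc 2 * (B : ℝ) * T.card * M.card ≤ 2 * B * T.card * (T.card * Nat.card R) := by gcongr
    _ = _ := by ring

end Pigeonhole

section Assembly

lemma exists_odd_card_primeFactors (k : ℕ) : ∃ r : ℕ, Odd r ∧ r.primeFactors.card = k := by
  obtain ⟨s, hs, hcard⟩ :=
    (Nat.infinite_setOfPred_prime.sdiff (Set.finite_singleton 2)).exists_subset_card_eq k
  have hp : ∀ p ∈ s, p.Prime := fun p hp => (hs hp).1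
  refine ⟨∏ p ∈ s, p, ?_, by rw [Nat.primeFactors_prod hp, hcard]⟩
  exact Finset.prod_induction _ Odd (fun _ _ => Odd.mul) odd_one fun p hps =>
    (hp p hps).odd_of_ne_two fun h => (hs hps).2 h

lemma pow_card_primeFactors_le_card_divisors {r : ℕ} (hr : r ≠ 0) (K : ℕ) :
    (K + 1) ^ r.primeFactors.card ≤ (r ^ K).divisors.card := by
  rcases eq_or_ne K 0 with rfl | hK
  · simp
  rw [Nat.card_divisors (pow_ne_zero _ hr), Nat.primeFactors_pow _ hK, ← Finset.prod_const]
  refine Finset.prod_le_prod' fun p hp => ?_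
  rw [Nat.factorization_pow, Finsupp.smul_apply, smul_eq_mul]
  have : 0 < r.factorization p := (Nat.prime_of_mem_primeFactors hp).factorization_pos_of_dvd hr
    (Nat.dvd_of_mem_primeFactors hp)
  gcongr
  exact Nat.le_mul_of_pos_right _ this

lemma eventually_exp_le_card_radimichael {ε : ℝ} (hε : 0 < ε) :
    ∀ᶠ K : ℕ in atTop, ∀ U : ℝ, (K : ℝ) ^ 12 ≤ U → U ≤ (K + 1 : ℝ) ^ 12 →
      ∀ x : ℝ, Real.exp (2 * U) ≤ x → Real.exp (U * (1 - 2 * ε)) ≤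
        Nat.card {n : ℕ | (n : ℝ) ≤ x ∧ 1 < n ∧ ¬ n.Prime ∧ rad (Nat.totient n) ∣ n - 1} := by
  obtain ⟨r, hrodd, hr14⟩ := exists_odd_card_primeFactors 14
  have hr0 : 0 < r := hrodd.pos
  have : NeZero r := ⟨hr0.ne'⟩
  have hr1 : (1 : ℝ) ≤ r := by exact_mod_cast hr0
  set τ : ℝ := min (ε / 2) (1 / 4) with hτdef
  have hτ : 0 < τ := by positivity
  have hτε : τ ≤ ε / 2 := min_le_left _ _
  have hτ4 : τ ≤ 1 / 4 := min_le_right _ _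
  filter_upwards [eventually_le_sum_windowPrimes r hrodd hτ (by linarith), eventually_ge_atTop 2,
    eventually_ge_atTop (96 * r), tendsto_natCast_atTop_atTop.eventually_ge_atTop (8 * r / ε)]
    with K hK hK2 hK96 hKε U hU hU' x hx
  have hK2' : (2 : ℝ) ≤ K := by exact_mod_cast hK2
  have hUK : (K : ℝ) ^ 2 ≤ U := le_trans (pow_le_pow_right₀ (by linarith) (by norm_num)) hU
  have hU4 : 4 ≤ U := by nlinarith
  have hU0 : 0 < U := by linarith
  set V : ℝ := (1 - τ) * U / (1 + τ) with hV
  have hVU : U * (1 - 2 * τ) ≤ V := by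
    rw [hV, le_div_iff₀ (by linarith)]
    nlinarith [mul_pos hU0 hτ, mul_pos (mul_pos hU0 hτ) hτ]
  have hV1 : 1 ≤ V := by nlinarith
  have hinj : Function.Injective (r * ·) := mul_right_injective₀ hr0.ne'
  set T : Finset ℕ := (r ^ K).divisors.image (r * ·) with hT
  have hTmem : ∀ t ∈ T, r ∣ t ∧ t ∣ r ^ (K + 1) := by
    intro t ht
    obtain ⟨d, hd, rfl⟩ := Finset.mem_image.1 ht
    refine ⟨dvd_mul_right _ _, ?_⟩
    rw [pow_succ']
    exact mul_dvd_mul_left r (Nat.dvd_of_mem_divisors hd)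
  have hpos : 0 < r ^ (K + 1) := pow_pos hr0 _
  have hTB : ∀ t ∈ T, 0 < t ∧ t ≤ r ^ (K + 1) := fun t ht =>
    ⟨Nat.pos_of_dvd_of_pos (hTmem t ht).2 hpos, Nat.le_of_dvd hpos (hTmem t ht).2⟩
  have hTpf : ∀ t ∈ T, t.primeFactors = r.primeFactors := by
    intro t ht
    refine subset_antisymm ?_ (Nat.primeFactors_mono (hTmem t ht).1 (hTB t ht).1.ne')
    have := Nat.primeFactors_mono (hTmem t ht).2 hpos.ne'
    rwa [Nat.primeFactors_pow _ (Nat.succ_ne_zero K)] at this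
  have hTcard : (K + 1) ^ 14 ≤ T.card := by
    rw [hT, Finset.card_image_of_injective _ hinj, ← hr14]
    exact pow_card_primeFactors_le_card_divisors hr0.ne' K
  have hTcard' : (32 * r * K : ℝ) * (2 + U) ≤ T.card := by
    have h1 : (96 * r : ℝ) ≤ K := by exact_mod_cast hK96
    have h2 : (2 : ℝ) ≤ (K + 1 : ℝ) ^ 12 * 2 := by
      have : (1 : ℝ) ≤ (K + 1 : ℝ) ^ 12 := one_le_pow₀ (by linarith)
      linarith
    calc (32 * r * K : ℝ) * (2 + U) ≤ 32 * r * K * ((K + 1) ^ 12 * 2 + (K + 1) ^ 12) := by gcongr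
      _ = (96 * r) * K * (K + 1) ^ 12 := by ring
      _ ≤ (K + 1) * (K + 1) * (K + 1) ^ 12 := by
        gcongr
        · linarith
        · linarith
      _ = (K + 1) ^ 14 := by ring
      _ ≤ T.card := by exact_mod_cast hTcard
  have hTle : (T.card : ℝ) ≤ (r : ℝ) ^ (K + 1) := by
    have h1 : T ⊆ Finset.Icc 1 (r ^ (K + 1)) := fun t ht => Finset.mem_Icc.2 (hTB t ht)
    have h2 := Finset.card_le_card h1
    rw [Nat.card_Icc, Nat.add_sub_cancel] at h2
    exact_mod_cast h2
  have hmain := le_mul_card_radimichael (T := T) (P := windowPrimes V U) (B := r ^ (K + 1))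
    (c := 32 * r * K) (w := Real.exp V) hU0 (by positivity)
    (by linarith [Real.add_one_le_exp V]) (fun p hp => by
      obtain ⟨h1, h2, h3⟩ := mem_windowPrimes.1 hp
      refine ⟨h1, ?_, h3.le⟩
      rw [← Real.le_log_iff_exp_le (Nat.cast_pos.2 h1.pos)]
      exact h2.le) hTB hTpf
    (fun t ht => hK U hU t (hTmem t ht).1 (hTmem t ht).2) hTcard' hx
  set N := Nat.card {n : ℕ | (n : ℝ) ≤ x ∧ 1 < n ∧ ¬ n.Prime ∧ rad (Nat.totient n) ∣ n - 1}
  have hself : ∀ y : ℝ, y ≤ Real.exp y := fun y => by linarith [Real.add_one_le_exp y]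
  have h3 : 2 * ((r ^ (K + 1) : ℕ) : ℝ) * (T.card : ℝ) ^ 2 ≤ Real.exp (ε * U) := by
    have h4 : (r : ℝ) ^ (K + 1) ≤ Real.exp ((K + 1) * r) := by
      have : (r : ℝ) ^ (K + 1) ≤ Real.exp r ^ (K + 1) := by
        gcongr
        exact hself _
      rw [← Real.exp_nat_mul] at this
      exact_mod_cast this
    push_cast
    calc 2 * (r : ℝ) ^ (K + 1) * (T.card : ℝ) ^ 2 ≤
        Real.exp 2 * Real.exp ((K + 1) * r) * Real.exp ((K + 1) * r) ^ 2 := by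
          gcongr
          · exact hself 2
          · exact hTle.trans h4
      _ = Real.exp (2 + 3 * ((K + 1) * r)) := by
          rw [← Real.exp_nat_mul, ← Real.exp_add, ← Real.exp_add]
          push_cast
          ring_nf
      _ ≤ Real.exp (ε * U) := by
          rw [Real.exp_le_exp]
          rw [div_le_iff₀ hε] at hKε
          have h5 : 2 + 3 * ((K + 1) * r) ≤ 8 * r * (K : ℝ) := by nlinarith
          have h6 : 8 * r * (K : ℝ) ≤ K * ε * K := by gcongr
          have h7 : ε * (K : ℝ) ^ 2 ≤ ε * U := by gcongr
          linarith
  have h8 : Real.exp V ≤ Real.exp (ε * U) * N :=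
    hmain.trans (mul_le_mul_of_nonneg_right h3 N.cast_nonneg)
  have h9 : Real.exp (U * (1 - 2 * ε)) * Real.exp (ε * U) ≤ Real.exp V := by
    rw [← Real.exp_add, Real.exp_le_exp]
    refine le_trans ?_ hVU
    nlinarith
  rw [mul_comm] at h9
  exact le_of_mul_le_mul_left (h9.trans h8) (Real.exp_pos _)

lemma exists_natCast_pow_le_le {U : ℝ} (hU : 0 ≤ U) {n : ℕ} (hn : n ≠ 0) {K₀ : ℕ}
    (hK₀ : (K₀ : ℝ) ^ n ≤ U) :
    ∃ K : ℕ, K₀ ≤ K ∧ (K : ℝ) ^ n ≤ U ∧ U ≤ (K + 1 : ℝ) ^ n := by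
  have h0 : 0 ≤ U ^ (n⁻¹ : ℝ) := Real.rpow_nonneg hU _
  have hpow : (U ^ (n⁻¹ : ℝ)) ^ n = U := Real.rpow_inv_natCast_pow hU hn
  refine ⟨⌊U ^ (n⁻¹ : ℝ)⌋₊, Nat.le_floor ?_, ?_, ?_⟩
  · rw [← hpow] at hK₀
    exact le_of_pow_le_pow_left₀ hn h0 hK₀
  · calc _ ≤ (U ^ (n⁻¹ : ℝ)) ^ n := by
          gcongr
          exact Nat.floor_le h0
      _ = U := hpow
  · calc U = (U ^ (n⁻¹ : ℝ)) ^ n := hpow.symm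
      _ ≤ _ := by
          gcongr
          exact (Nat.lt_floor_add_one _).le

end Assembly

end Preliminaries

/-- The count of radimichael numbers up to `x` is at least `x ^ (1/2 + o(1))` as `x → ∞`. -/
theorem radimichael_count_lower_bound :
    ∀ ε : ℝ, 0 < ε → ∃ x₀ : ℝ, ∀ x : ℝ, x₀ ≤ x →
      x ^ ((1 : ℝ) / 2 - ε) ≤
        (Nat.card {n : ℕ | (n : ℝ) ≤ x ∧ 1 < n ∧ ¬ n.Prime ∧
          rad (Nat.totient n) ∣ n - 1} : ℝ) := by
  intro ε hε
  obtain ⟨K₀, hK₀⟩ := Filter.eventually_atTop.1 (eventually_exp_le_card_radimichael hε)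
  refine ⟨Real.exp (2 * (K₀ : ℝ) ^ 12), fun x hx => ?_⟩
  have hx0 : 0 < x := (Real.exp_pos _).trans_le hx
  have hlog : (K₀ : ℝ) ^ 12 ≤ Real.log x / 2 := by
    have := (Real.le_log_iff_exp_le hx0).2 hx
    linarith
  obtain ⟨K, hKK₀, hK, hK'⟩ :=
    exists_natCast_pow_le_le (le_trans (by positivity) hlog) (by norm_num) hlog
  have h := hK₀ K hKK₀ _ hK hK' x (by
    rw [mul_div_cancel₀ _ two_ne_zero, Real.exp_log hx0])
  rw [Real.rpow_def_of_pos hx0]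
  convert h using 2
  ring
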